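/- arXiv:1911.08574 — 6 statements merged into one kernel-verified Lean document; each statement's English description precedes it below -/
import Mathlib

section
/- Every monoid satisfying the identities x²y² ≈ y²x² and xzxyxty ≈ xzyxty also satisfies the identities xyx ≈ xyx² and xtyzxy ≈ xtyzyx. -/
open FreeMonoid

/-- Words over the countably infinite alphabet `ℕ`. -/
abbrev Word : Type := FreeMonoid ℕ

/-- The word corresponding to a list of letters. -/
def wd (l : List ℕ) : Word := FreeMonoid.ofList l

/-- A monoid `M` satisfies the identity `e.1 ≈ e.2`. -/
def MSat (M : Type*) [Monoid M] (e : Word × Word) : Prop :=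
  ∀ φ : Word →* M, φ e.1 = φ e.2

/-- A monoid `M` satisfies every identity of `S`. -/
def SatAll (M : Type*) [Monoid M] (S : Set (Word × Word)) : Prop :=
  ∀ e ∈ S, MSat M e

/-- The varieties `Mod S` and `Mod T` coincide (they have exactly the same members). -/
def VarEq.{u} (S T : Set (Word × Word)) : Prop :=
  ∀ (M : Type u) [Monoid M], SatAll M S ↔ SatAll M T

/-- The variety `Mod S` is finitely based. -/
def FinitelyBased.{u} (S : Set (Word × Word)) : Prop :=
  ∃ T : Finset (Word × Word), VarEq.{u} S (↑T)

/-- `G` is a subgroup (a subsemigroup which is a group) of the monoid `M`. -/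
def IsSubgroupIn (M : Type*) [Monoid M] (G : Set M) : Prop :=
  (∀ a ∈ G, ∀ b ∈ G, a * b ∈ G) ∧
    ∃ e ∈ G, (∀ g ∈ G, e * g = g ∧ g * e = g) ∧ ∀ g ∈ G, ∃ h ∈ G, g * h = e ∧ h * g = e

/-- A monoid is aperiodic if all its subgroups have exactly one element. -/
def AperiodicMonoid (M : Type*) [Monoid M] : Prop :=
  ∀ G : Set M, IsSubgroupIn M G → ∀ a ∈ G, ∀ b ∈ G, a = b

/-- The idempotents of `M` commute. -/
def CommIdem (M : Type*) [Monoid M] : Prop :=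
  ∀ e f : M, e * e = e → f * f = f → e * f = f * e

/-- `w` is a factor (contiguous subword) of some word of `W`. -/
def IsFactorIn (W : Set (List ℕ)) (w : List ℕ) : Prop := ∃ s ∈ W, w <:+: s

theorem IsFactorIn.left {W : Set (List ℕ)} {u v : List ℕ} (h : IsFactorIn W (u ++ v)) :
    IsFactorIn W u := by
  obtain ⟨s, hs, hf⟩ := h
  exact ⟨s, hs, (List.prefix_append u v).isInfix.trans hf⟩

theorem IsFactorIn.right {W : Set (List ℕ)} {u v : List ℕ} (h : IsFactorIn W (u ++ v)) :
    IsFactorIn W v := by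
  obtain ⟨s, hs, hf⟩ := h
  exact ⟨s, hs, (List.suffix_append u v).isInfix.trans hf⟩

/-- The Rees congruence on the free monoid identifying all non-factors of words of `W`. -/
def reesCon (W : Set (List ℕ)) : Con Word where
  r u v := u = v ∨ (¬ IsFactorIn W (toList u) ∧ ¬ IsFactorIn W (toList v))
  iseqv := ⟨fun _ => Or.inl rfl, fun h => by tauto, fun h₁ h₂ => by
    rcases h₁ with rfl | h₁ <;> rcases h₂ with rfl | h₂ <;> tauto⟩
  mul' := by
    rintro w x y z (rfl | ⟨hw, hx⟩) (rfl | ⟨hy, hz⟩)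
    · exact Or.inl rfl
    · refine Or.inr ⟨fun h => hy ?_, fun h => hz ?_⟩
      · rw [toList_mul] at h; exact h.right
      · rw [toList_mul] at h; exact h.right
    · refine Or.inr ⟨fun h => hw ?_, fun h => hx ?_⟩
      · rw [toList_mul] at h; exact h.left
      · rw [toList_mul] at h; exact h.left
    · refine Or.inr ⟨fun h => hw ?_, fun h => hx ?_⟩
      · rw [toList_mul] at h; exact h.left
      · rw [toList_mul] at h; exact h.left

/-- The Rees quotient `S(W)` of the free monoid over the ideal of all words that
are not factors of any word in `W`. -/
abbrev SMon (W : Set (List ℕ)) : Type := (reesCon W).Quotient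

/-- The equational theory of the monoid `N`; `Mod (Th N)` is the variety generated by `N`. -/
def Th (N : Type*) [Monoid N] : Set (Word × Word) := {e | MSat N e}

/-- The reverse of a word. -/
def revW (w : Word) : Word := ofList (toList w).reverse

/-- The set of identities defining the dual variety. -/
def dualSet (S : Set (Word × Word)) : Set (Word × Word) :=
  (fun e : Word × Word => (revW e.1, revW e.2)) '' S

/-- letters: x = 0, y = 1, z = 2, t = 3. -/
def Oset : Set (Word × Word) :=
  {(wd [0,0,1,1], wd [1,1,0,0]), (wd [0,2,0,1,0,3,1], wd [0,2,1,0,3,1])}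

def Kset : Set (Word × Word) :=
  {(wd [0,1,0], wd [0,1,0,0]), (wd [0,0,1,1], wd [1,1,0,0]), (wd [0,0,1], wd [0,0,1,0])}

def Qset : Set (Word × Word) :=
  {(wd [0,1,0], wd [0,1,0,0]), (wd [0,0,1,1], wd [1,1,0,0]), (wd [0,1,0], wd [0,0,1,0])}

def Eset : Set (Word × Word) :=
  {(wd [0,0,1,1], wd [1,1,0,0]), (wd [0,0], wd [0,0,0]), (wd [1,0,0], wd [0,1,0])}

def F0set : Set (Word × Word) :=
  {(wd [0,1,0], wd [0,1,0,0]), (wd [0,0,1,1], wd [1,1,0,0]),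
   (wd [0,1,2,0,1], wd [1,0,2,0,1]), (wd [0,0,1], wd [0,0,1,0])}

/-- The identity `x z_{π(1)}⋯z_{π(n)} x (t₁z₁)⋯(tₙzₙ) ≈ x² z_{π(1)}⋯z_{π(n)} (t₁z₁)⋯(tₙzₙ)`,
with letters `x = 0`, `zᵢ = 2i+1`, `tᵢ = 2i+2`. -/
def Jscheme (n : ℕ) (π : Equiv.Perm (Fin n)) : Word × Word :=
  (of 0 * ((List.finRange n).map fun i => of (2 * (π i : ℕ) + 1)).prod * of 0 *
      ((List.finRange n).map fun i => of (2 * (i : ℕ) + 2) * of (2 * (i : ℕ) + 1)).prod,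
   of 0 * of 0 * ((List.finRange n).map fun i => of (2 * (π i : ℕ) + 1)).prod *
      ((List.finRange n).map fun i => of (2 * (i : ℕ) + 2) * of (2 * (i : ℕ) + 1)).prod)

/-- The defining identities of the variety `J`. -/
def Jset : Set (Word × Word) :=
  {(wd [0,1,0], wd [0,1,0,0]), (wd [0,0,1,1], wd [1,1,0,0]),
   (wd [0,1,2,0,1], wd [1,0,2,0,1]), (wd [0,1,0,2,3,0], wd [0,1,0,2,0,3,0])} ∪
  {e | ∃ n : ℕ, 1 ≤ n ∧ ∃ π : Equiv.Perm (Fin n), e = Jscheme n π}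

/-- The set of letters occurring in a word. -/
def conL (w : List ℕ) : Set ℕ := {a | a ∈ w}

/-- The set of simple letters of a word. -/
def simpleSet (w : List ℕ) : Set ℕ := {a | w.count a = 1}

/-- The set of multiple letters of a word. -/
def mulSet (w : List ℕ) : Set ℕ := {a | 2 ≤ w.count a}

/-- The position of the `i`-th occurrence (`i ≥ 1`) of the letter `a` in `w`. -/
def nthOccIdx (w : List ℕ) (a : ℕ) (i : ℕ) : ℕ :=
  ((List.range w.length).filter fun j => w.getD j (a + 1) == a).getD (i - 1) w.length

/-- `h_i(w,a)`: the right-most divider (simple letter) of `w` preceding the `i`-th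
occurrence of `a` in `w`; `none` encodes the empty divider `t₀`. -/
def hdiv (w : List ℕ) (a : ℕ) (i : ℕ) : Option ℕ :=
  ((w.take (nthOccIdx w a i)).filter fun b => w.count b == 1).getLast?

/-- `t(w,a)`: the right-most divider of `w` preceding the last occurrence of `a` in `w`. -/
def tdiv (w : List ℕ) (a : ℕ) : Option ℕ := hdiv w a (w.count a)

/-- The word `b₀ t₁ b₁ t₂ b₂ ⋯ tₘ bₘ` built from blocks and dividers. -/
def assemble (b0 : List ℕ) (ps : List (ℕ × List ℕ)) : List ℕ :=
  b0 ++ (ps.map fun p => p.1 :: p.2).flatten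

/-- `t₀ b₀ t₁ b₁ ⋯ tₘ bₘ` is the decomposition of `w`: the `tᵢ` are the dividers
(simple letters) of `w` and the blocks `bᵢ` consist of multiple letters. -/
def IsDecomp (w b0 : List ℕ) (ps : List (ℕ × List ℕ)) : Prop :=
  w = assemble b0 ps ∧ (∀ p ∈ ps, w.count p.1 = 1) ∧
    (∀ a ∈ b0, 2 ≤ w.count a) ∧ ∀ p ∈ ps, ∀ a ∈ p.2, 2 ≤ w.count a

/-- The identity `u ≈ v` is well-balanced: `u` and `v` have the same dividers in the
same order and corresponding blocks have the same number of occurrences of each letter. -/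
def WellBalanced (u v : List ℕ) : Prop :=
  ∃ b0 ps c0 qs, IsDecomp u b0 ps ∧ IsDecomp v c0 qs ∧
    ps.map Prod.fst = qs.map Prod.fst ∧
    List.Forall₂ (fun b c : List ℕ => ∀ a, b.count a = c.count a)
      (b0 :: ps.map Prod.snd) (c0 :: qs.map Prod.snd)

/-- `∏_{i=a}^{b} tᵢ eᵢ` where `tᵢ = i+1`, `eᵢ = x = 0` for odd `i` and `eᵢ = y = 1`
for even `i`. -/
def prodTE (a b : ℕ) : Word :=
  ((List.range' a (b + 1 - a)).map fun i =>
    of (i + 1) * of (if i % 2 = 1 then 0 else 1)).prod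

def alphaId (n : ℕ) : Word × Word :=
  (wd [0,1] * prodTE 1 (n+1), wd [1,0] * prodTE 1 (n+1))

def betaId (n : ℕ) : Word × Word :=
  (wd [1,0,0] * prodTE 2 (n+1), wd [0,1,0] * prodTE 1 n)

def gammaId (n : ℕ) : Word × Word :=
  (wd [0,0,1] * prodTE 1 (n+1), wd [0,1,0] * prodTE 1 (n+1))

def gammaId' (n : ℕ) : Word × Word :=
  (wd [0,0,1] * prodTE 2 (n+1), wd [0,1,0] * prodTE 2 (n+1))

/-- The family `Φ` of identities from Lemma 3.5 (letters `x = 0`, `y = 1`, `t = 2`). -/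
def PhiSet : Set (Word × Word) :=
  {(wd [0,1,2,0,1], wd [1,0,2,0,1]), (wd [1,0,0,2,0,1], wd [0,1,0,2,0,1]),
   (wd [0,0,1,2,0,1], wd [0,1,0,2,0,1])} ∪
  {e | ∃ n : ℕ, 1 ≤ n ∧ (e = alphaId n ∨ e = betaId n ∨ e = gammaId n ∨ e = gammaId' n)}
/-- Every monoid satisfying `x²y² ≈ y²x²` and `xzxyxty ≈ xzyxty` also satisfies
`xyx ≈ xyx²` and `xtyzxy ≈ xtyzyx` (letters `x = 0`, `y = 1`, `z = 2`, `t = 3`). -/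
theorem identities_in_O (M : Type*) [Monoid M]
    (h1 : MSat M (wd [0,0,1,1], wd [1,1,0,0]))
    (h2 : MSat M (wd [0,2,0,1,0,3,1], wd [0,2,1,0,3,1])) :
    MSat M (wd [0,1,0], wd [0,1,0,0]) ∧
    MSat M (wd [0,3,1,2,0,1], wd [0,3,1,2,1,0]) := by
  have a1 : ∀ x y : M, x * x * y * y = y * y * x * x := by
    intro x y
    have h := h1 (FreeMonoid.lift (fun n : ℕ => if n = 0 then x else y))
    simpa [wd, FreeMonoid.lift_apply, mul_assoc] using h
  have a2 : ∀ x z : M, x * z * x * x = x * z * x := by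
    intro x z
    have h := h2 (FreeMonoid.lift (fun n : ℕ => if n = 0 then x else if n = 2 then z else 1))
    simpa [wd, FreeMonoid.lift_apply, mul_assoc] using h
  have key : ∀ x t y z : M, x * t * y * z * x * y = x * t * y * z * x * x * y * y := by
    intro x t y z
    have e1 := a2 x (t * y * z)
    have e2 := a2 y (z * x * x)
    calc x * t * y * z * x * y = (x * (t * y * z) * x) * y := by simp only [mul_assoc]
      _ = x * t * (y * (z * x * x) * y) := by rw [← e1]; simp only [mul_assoc]
      _ = _ := by rw [← e2]; simp only [mul_assoc]
  have key' : ∀ x t y z : M, x * t * y * z * y * x = x * t * y * z * y * y * x * x := by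
    intro x t y z
    have e1 := a2 y z
    have e2 := a2 x (t * y * z * y * y)
    calc x * t * y * z * y * x = x * t * (y * z * y) * x := by simp only [mul_assoc]
      _ = x * (t * y * z * y * y) * x := by rw [← e1]; simp only [mul_assoc]
      _ = _ := by rw [← e2]; simp only [mul_assoc]
  constructor
  · intro φ
    have h := a2 (φ (of 0)) (φ (of 1))
    have e1 : wd [0,1,0] = of 0 * of 1 * of 0 := rfl
    have e2 : wd [0,1,0,0] = of 0 * of 1 * of 0 * of 0 := rfl
    simp only [e1, e2, map_mul]
    exact h.symm
  · intro φ
    have e1 : wd [0,3,1,2,0,1] = of 0 * of 3 * of 1 * of 2 * of 0 * of 1 := rfl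
    have e2 : wd [0,3,1,2,1,0] = of 0 * of 3 * of 1 * of 2 * of 1 * of 0 := rfl
    simp only [e1, e2, map_mul]
    rw [key, key']
    have h := a1 (φ (of 0)) (φ (of 1))
    simp only [mul_assoc] at h ⊢
    rw [h]
end

section
/- Let v₁, v₂, v₃ be possibly empty words, a a letter, and set w = v₁ a v₂ a v₃. If a occurs in v₁ and every letter occurring in v₂ occurs at least twice in w, then every monoid satisfying x²y² ≈ y²x² and xzxyxty ≈ xzyxty satisfies the identity w ≈ v₁ v₂ a v₃. -/
open FreeMonoid

section Helpers

variable {M : Type*} [Monoid M]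

theorem aux_absorb (hx : ∀ x z : M, x * z * x * x = x * z * x)
    (f : ℕ → M) (a : ℕ) (u : List ℕ) (ha : a ∈ u) :
    (u.map f).prod * f a * f a = (u.map f).prod * f a := by
  obtain ⟨p, q, rfl⟩ := List.append_of_mem ha
  have := hx (f a) (q.map f).prod
  simp only [List.map_append, List.map_cons, List.prod_append, List.prod_cons]
  calc _ = (p.map f).prod * (f a * (q.map f).prod * f a * f a) := by simp only [mul_assoc]
    _ = _ := by rw [this]; simp only [mul_assoc]

theorem aux_key (hc : ∀ x y : M, x * x * y * y = y * y * x * x)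
    (h2 : ∀ x y z t : M, x * z * x * y * x * t * y = x * z * y * x * t * y)
    (f : ℕ → M) (a b : ℕ) (u v : List ℕ) (ha : a ∈ u) (hb : b ∈ u ∨ b ∈ v) :
    (u.map f).prod * f a * f b * f a * (v.map f).prod
      = (u.map f).prod * f b * f a * (v.map f).prod := by
  have hx : ∀ x z : M, x * z * x * x = x * z * x := fun x z => by
    have := h2 x 1 z 1
    simpa using this
  rcases hb with hb | hb
  · congr 1
    have A := aux_absorb hx f a u ha
    have B := aux_absorb hx f b u hb
    have A2 := aux_absorb hx f a (u ++ [b]) (by simp [ha])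
    have B2 := aux_absorb hx f b (u ++ [a]) (by simp [hb])
    simp only [List.map_append, List.map_cons, List.map_nil, List.prod_append,
      List.prod_cons, List.prod_nil, mul_one] at A2 B2
    have C := hc (f a) (f b)
    calc (u.map f).prod * f a * f b * f a
        = (u.map f).prod * f a * f b * f b * f a := by rw [B2]
      _ = (u.map f).prod * f a * f a * f b * f b * f a := by rw [A]
      _ = (u.map f).prod * (f a * f a * f b * f b) * f a := by simp only [mul_assoc]
      _ = (u.map f).prod * f b * f b * f a * f a * f a := by rw [C]; simp only [mul_assoc]
      _ = (u.map f).prod * f b * f a := by rw [B, A2, A2]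
  · obtain ⟨p, q, rfl⟩ := List.append_of_mem ha
    obtain ⟨r, s, rfl⟩ := List.append_of_mem hb
    have := h2 (f a) (f b) (q.map f).prod (r.map f).prod
    simp only [List.map_append, List.map_cons, List.prod_append, List.prod_cons]
    calc _ = (p.map f).prod * (f a * (q.map f).prod * f a * f b * f a * (r.map f).prod * f b)
            * (s.map f).prod := by simp only [mul_assoc]
      _ = _ := by rw [this]; simp only [mul_assoc]

theorem aux_main (hc : ∀ x y : M, x * x * y * y = y * y * x * x)
    (h2 : ∀ x y z t : M, x * z * x * y * x * t * y = x * z * y * x * t * y)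
    (f : ℕ → M) (a : ℕ) (v1 : List ℕ) (ha : a ∈ v1) (v2 : List ℕ) :
    ∀ v3 : List ℕ, (∀ b ∈ v2, 2 ≤ (v1 ++ a :: (v2 ++ a :: v3)).count b) →
    ((v1 ++ a :: (v2 ++ a :: v3)).map f).prod = ((v1 ++ (v2 ++ a :: v3)).map f).prod := by
  induction v2 using List.reverseRecOn with
  | nil =>
    intro v3 _
    have hx : ∀ x z : M, x * z * x * x = x * z * x := fun x z => by
      have := h2 x 1 z 1
      simpa using this
    have A := aux_absorb hx f a v1 ha
    simp only [List.map_append, List.map_cons, List.prod_append, List.prod_cons, List.nil_append,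
      ← mul_assoc, A]
  | append_singleton w b ih =>
    intro v3 h
    have hb : b ∈ v1 ++ w ∨ b ∈ v3 := by
      have := h b (by simp)
      by_contra hn
      simp only [List.mem_append, not_or] at hn
      have hab : a ≠ b := by rintro rfl; exact hn.1.1 ha
      simp [List.count_append, List.count_cons, hab, List.count_eq_zero_of_not_mem hn.1.1,
        List.count_eq_zero_of_not_mem hn.1.2, List.count_eq_zero_of_not_mem hn.2] at this
    have I := ih (b :: a :: v3) (by
      intro c hcw
      have := h c (by simp [hcw])
      simp only [List.count_append, List.count_cons, List.count_nil] at this ⊢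
      omega)
    have K1 := aux_key hc h2 f a b (v1 ++ a :: w) v3 (by simp [ha]) (by
      rcases hb with hb | hb
      · left; simp only [List.mem_append, List.mem_cons] at hb ⊢; tauto
      · exact Or.inr hb)
    have K2 := aux_key hc h2 f a b (v1 ++ w) v3 (by simp [ha]) hb
    simp only [List.map_append, List.map_cons, List.map_nil, List.prod_append, List.prod_cons,
      List.prod_nil, mul_one, mul_assoc] at I K1 K2 ⊢
    rw [← K1, I, K2]

end Helpers

/-- Let `w = v₁ a v₂ a v₃` with `a` occurring in `v₁` and every letter of `v₂`
multiple in `w`.  Then every monoid satisfying `x²y² ≈ y²x²` and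
`xzxyxty ≈ xzyxty` satisfies `w ≈ v₁ v₂ a v₃`. -/
theorem move_second_occurrence (v1 v2 v3 : Word) (a : ℕ)
    (ha : a ∈ toList v1)
    (hmul : ∀ b ∈ toList v2,
      2 ≤ (toList (v1 * of a * v2 * of a * v3)).count b)
    (M : Type*) [Monoid M]
    (h1 : MSat M (wd [0,0,1,1], wd [1,1,0,0]))
    (h2 : MSat M (wd [0,2,0,1,0,3,1], wd [0,2,1,0,3,1])) :
    MSat M (v1 * of a * v2 * of a * v3, v1 * v2 * of a * v3) := by
  intro φ
  have hφ : ∀ w : Word, φ w = ((toList w).map fun n => φ (of n)).prod := by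
    intro w
    conv_lhs => rw [← FreeMonoid.lift_restrict φ]
    rw [FreeMonoid.lift_apply]
    rfl
  have hc : ∀ x y : M, x * x * y * y = y * y * x * x := by
    intro x y
    have := h1 (FreeMonoid.lift fun n => if n = 0 then x else y)
    simpa [wd, FreeMonoid.lift_apply, mul_assoc] using this
  have hd : ∀ x y z t : M, x * z * x * y * x * t * y = x * z * y * x * t * y := by
    intro x y z t
    have := h2 (FreeMonoid.lift fun n =>
      if n = 0 then x else if n = 1 then y else if n = 2 then z else t)
    simpa [wd, FreeMonoid.lift_apply, mul_assoc] using this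
  have key := aux_main hc hd (fun n => φ (of n)) a (toList v1) ha (toList v2) (toList v3) (by
    intro b hb
    have := hmul b hb
    simpa [toList_mul, toList_of] using this)
  rw [hφ, hφ]
  simpa [toList_mul, toList_of] using key
end

section
/- Let v₁ and v₂ be words and let x₁, x₂, …, xₙ be a list (in any order, without repetitions) of the distinct letters occurring in v₂. If every letter occurring in v₂ also occurs in v₁, then every monoid satisfying x²y² ≈ y²x² and xzxyxty ≈ xzyxty satisfies the identity v₁v₂ ≈ v₁x₁x₂⋯xₙ. -/
open FreeMonoid

theorem so_absorb {M : Type*} [Monoid M]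
    (h2 : MSat M (wd [0,2,0,1,0,3,1], wd [0,2,1,0,3,1])) (x z : M) :
    x * z * x * x = x * z * x := by
  have h := h2 (FreeMonoid.lift fun n => if n = 0 then x else if n = 2 then z else 1)
  simpa [wd, FreeMonoid.lift_apply, mul_assoc] using h

theorem so_comm {M : Type*} [Monoid M]
    (h1 : MSat M (wd [0,0,1,1], wd [1,1,0,0])) (x y : M) :
    x * x * (y * y) = y * y * (x * x) := by
  have h := h1 (FreeMonoid.lift fun n => if n = 0 then x else y)
  simpa [wd, FreeMonoid.lift_apply, mul_assoc] using h

theorem so_word_absorb {M : Type*} [Monoid M]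
    (h2 : MSat M (wd [0,2,0,1,0,3,1], wd [0,2,1,0,3,1])) (g : ℕ → M) (w : List ℕ) (a : ℕ)
    (ha : a ∈ w) (m : M) :
    (w.map g).prod * m * g a * g a = (w.map g).prod * m * g a := by
  obtain ⟨s, t, rfl⟩ := List.append_of_mem ha
  have h := congrArg (fun r => (s.map g).prod * r) (so_absorb h2 (g a) ((t.map g).prod * m))
  simpa [mul_assoc] using h

theorem so_word_comm {M : Type*} [Monoid M]
    (h1 : MSat M (wd [0,0,1,1], wd [1,1,0,0]))
    (h2 : MSat M (wd [0,2,0,1,0,3,1], wd [0,2,1,0,3,1])) (g : ℕ → M) (w : List ℕ) (a b : ℕ)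
    (ha : a ∈ w) (hb : b ∈ w) :
    (w.map g).prod * g a * g b = (w.map g).prod * g b * g a := by
  have key : ∀ c d : ℕ, c ∈ w → d ∈ w →
      (w.map g).prod * g c * g d = (w.map g).prod * (g c * g c * (g d * g d)) := by
    intro c d hc hd
    have e1 := so_word_absorb h2 g w c hc 1
    have e2 := so_word_absorb h2 g w d hd (g c)
    rw [mul_one] at e1
    rw [← e2, ← e1]
    simp only [mul_assoc]
  rw [key a b ha hb, key b a hb ha, so_comm h1]

theorem so_perm {M : Type*} [Monoid M]
    (h1 : MSat M (wd [0,0,1,1], wd [1,1,0,0]))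
    (h2 : MSat M (wd [0,2,0,1,0,3,1], wd [0,2,1,0,3,1])) (g : ℕ → M) {l l' : List ℕ}
    (h : l.Perm l') : ∀ w : List ℕ, (∀ a ∈ l, a ∈ w) →
      (w.map g).prod * (l.map g).prod = (w.map g).prod * (l'.map g).prod := by
  induction h with
  | nil => intro w _; rfl
  | cons x _ ih =>
    intro w hw
    have h := ih (w ++ [x]) (fun a ha => by simp [hw a (by simp [ha])])
    simpa [mul_assoc] using h
  | swap x y l =>
    intro w hw
    have h := congrArg (fun r => r * (l.map g).prod)
      (so_word_comm h1 h2 g w y x (hw _ (by simp)) (hw _ (by simp)))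
    simpa [mul_assoc] using h
  | trans p _ ih1 ih2 =>
    intro w hw
    exact (ih1 w hw).trans (ih2 w fun a ha => hw a (p.mem_iff.2 ha))

theorem so_dedup {M : Type*} [Monoid M]
    (h1 : MSat M (wd [0,0,1,1], wd [1,1,0,0]))
    (h2 : MSat M (wd [0,2,0,1,0,3,1], wd [0,2,1,0,3,1])) (g : ℕ → M) (l : List ℕ) :
    ∀ w : List ℕ, (∀ a ∈ l, a ∈ w) →
      (w.map g).prod * (l.map g).prod = (w.map g).prod * (l.dedup.map g).prod := by
  induction l with
  | nil => intro w _; rfl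
  | cons x t ih =>
    intro w hw
    by_cases hx : x ∈ t
    · rw [List.dedup_cons_of_mem hx, ← ih w (fun a ha => hw a (by simp [ha]))]
      have hp := List.perm_cons_erase hx
      rw [so_perm h1 h2 g (hp.cons x) w hw,
        so_perm h1 h2 g hp w (fun a ha => hw a (by simp [ha]))]
      have h := congrArg (fun r => r * ((t.erase x).map g).prod)
        (so_word_absorb h2 g w x (hw x (by simp)) 1)
      simpa [mul_assoc] using h
    · rw [List.dedup_cons_of_notMem hx]
      have h := ih (w ++ [x]) (fun a ha => by simp [hw a (by simp [ha])])
      simpa [mul_assoc] using h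

/-- Let `con(v₂) = {x₁, …, xₙ} ⊆ con(v₁)`.  Then every monoid satisfying
`x²y² ≈ y²x²` and `xzxyxty ≈ xzyxty` satisfies `v₁v₂ ≈ v₁x₁x₂⋯xₙ`. -/
theorem second_occurrences (v1 v2 : Word) (xs : List ℕ) (hnd : xs.Nodup)
    (hxs : ∀ a, a ∈ xs ↔ a ∈ toList v2)
    (hsub : ∀ a ∈ toList v2, a ∈ toList v1)
    (M : Type*) [Monoid M]
    (h1 : MSat M (wd [0,0,1,1], wd [1,1,0,0]))
    (h2 : MSat M (wd [0,2,0,1,0,3,1], wd [0,2,1,0,3,1])) :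
    MSat M (v1 * v2, v1 * FreeMonoid.ofList xs) := by
  intro φ
  have hφ : ∀ w : Word, φ w = ((toList w).map fun n => φ (of n)).prod := by
    intro w
    have e : φ = FreeMonoid.lift (fun n => φ (of n)) := by
      ext n; simp
    conv_lhs => rw [e]
    rw [FreeMonoid.lift_apply]
  change φ (v1 * v2) = φ (v1 * FreeMonoid.ofList xs)
  rw [map_mul, map_mul, hφ v1, hφ v2, hφ (FreeMonoid.ofList xs), toList_ofList]
  rw [so_dedup h1 h2 _ (toList v2) (toList v1) hsub]
  refine so_perm h1 h2 _ ?_ (toList v1) (fun a ha => hsub a (List.mem_dedup.1 ha))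
  exact (List.perm_ext_iff_of_nodup (List.nodup_dedup _) hnd).2 fun a => by
    rw [List.mem_dedup, hxs]
end

section
/- Let u ≈ v be an identity that holds in every monoid satisfying the defining identities of F₀ and in every monoid satisfying the defining identities of E. Then there exists a well-balanced identity u′ ≈ v′ such that either Mod({x²y² ≈ y²x², xzxyxty ≈ xzyxty, u ≈ v}) = Mod({x²y² ≈ y²x², xzxyxty ≈ xzyxty, u′ ≈ v′}), or Mod({x²y² ≈ y²x², xzxyxty ≈ xzyxty, u ≈ v}) = Mod({x²y² ≈ y²x², xzxyxty ≈ xzyxty, u′ ≈ v′, xyxztx ≈ xyxzxtx}). -/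
open FreeMonoid

universe uM

namespace RWB

theorem hom_ofList {M : Type*} [Monoid M] (φ : Word →* M) (l : List ℕ) :
    φ (ofList l) = (l.map fun b => φ (of b)).prod := by
  induction l with
  | nil => simp
  | cons a l ih => simp [ofList_cons, ih]

theorem sat_list {M : Type*} [Monoid M] {u v : Word} (h : MSat M (u, v)) (f : ℕ → M) :
    ((toList u).map f).prod = ((toList v).map f).prod := by
  have := h (FreeMonoid.lift f)
  simpa [FreeMonoid.lift_apply] using this

theorem prod_pow {M : Type*} [Monoid M] (f : ℕ → M) (a : ℕ) (X : M) (l : List ℕ)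
    (h : ∀ b ∈ l, f b = if b = a then X else 1) : (l.map f).prod = X ^ l.count a := by
  induction l with
  | nil => simp
  | cons b l ih =>
    have h1 := h b (by simp)
    have h2 := ih (fun c hc => h c (by simp [hc]))
    rw [List.map_cons, List.prod_cons, h1, h2]
    by_cases hb : b = a
    · simp [hb, pow_succ']
    · simp [hb]

theorem sat_ulift {N : Type} [Monoid N] {S : Set (Word × Word)} (h : SatAll N S) :
    SatAll (ULift.{uM} N) S := by
  intro e he φ
  have := h e he ((MulEquiv.ulift : ULift.{uM} N ≃* N).toMonoidHom.comp φ)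
  simpa using this

theorem sat_down {N : Type} [Monoid N] {e : Word × Word} (h : MSat (ULift.{uM} N) e) :
    MSat N e := by
  intro φ
  have := h ((MulEquiv.ulift : ULift.{uM} N ≃* N).symm.toMonoidHom.comp φ)
  simpa using this

/-! ### A monoid in `E` -/

inductive EM where
  | one | e | t | te | z
  deriving DecidableEq

def EM.mul : EM → EM → EM
  | .one, b => b
  | a, .one => a
  | .z, _ => .z
  | _, .z => .z
  | .e, .e => .e
  | .e, .t => .t
  | .e, .te => .te
  | .t, .e => .te
  | .t, .t => .z
  | .t, .te => .z
  | .te, .e => .te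
  | .te, .t => .z
  | .te, .te => .z

instance : Monoid EM where
  mul := EM.mul
  one := .one
  mul_assoc := by intro a b c; cases a <;> cases b <;> cases c <;> rfl
  one_mul := by intro a; cases a <;> rfl
  mul_one := by intro a; cases a <;> rfl

theorem EM_sat : SatAll EM Eset := by
  intro e he
  simp only [Eset, Set.mem_insert_iff, Set.mem_singleton_iff] at he
  rcases he with rfl | rfl | rfl <;> intro φ <;>
    simp only [wd, hom_ofList, List.map_cons, List.map_nil, List.prod_cons, List.prod_nil] <;>
    generalize φ (of 0) = x <;> try generalize φ (of 1) = y
  · cases x <;> cases y <;> rfl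
  · cases x <;> rfl
  · cases x <;> cases y <;> rfl

/-! ### A monoid in `F₀` -/

inductive FM where
  | x0 | x1 | x2 | t0 | t0x | t0xx | xt | xtx | xxt | z
  deriving DecidableEq

/-- encode as total count and position of `t` -/
def FM.c : FM → ℕ × ℕ
  | .x0 => (0, 3) | .x1 => (1, 3) | .x2 => (2, 3)
  | .t0 => (0, 0) | .t0x => (1, 0) | .t0xx => (2, 0)
  | .xt => (1, 1) | .xtx => (2, 1) | .xxt => (2, 2) | .z => (0, 4)

def FM.d : ℕ → ℕ → FM
  | 0, 3 => .x0 | 1, 3 => .x1 | _, 3 => .x2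
  | 0, 0 => .t0 | 1, 0 => .t0x | _, 0 => .t0xx
  | 1, 1 => .xt | _, 1 => .xtx | _, 2 => .xxt | _, _ => .z

def FM.mul (a b : FM) : FM :=
  if a = .z then .z else if b = .z then .z else
  if a.c.2 = 3 then
    (if b.c.2 = 3 then FM.d (min 2 (a.c.1 + b.c.1)) 3
     else FM.d (min 2 (a.c.1 + b.c.1)) (min 2 (a.c.1 + b.c.2)))
  else (if b.c.2 = 3 then FM.d (min 2 (a.c.1 + b.c.1)) a.c.2 else .z)

instance : Monoid FM where
  mul := FM.mul
  one := .x0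
  mul_assoc := by intro a b c; cases a <;> cases b <;> cases c <;> rfl
  one_mul := by intro a; cases a <;> rfl
  mul_one := by intro a; cases a <;> rfl

theorem FM_sat : SatAll FM F0set := by
  intro e he
  simp only [F0set, Set.mem_insert_iff, Set.mem_singleton_iff] at he
  rcases he with rfl | rfl | rfl | rfl <;> intro φ <;>
    simp only [wd, hom_ofList, List.map_cons, List.map_nil, List.prod_cons, List.prod_nil] <;>
    generalize φ (of 0) = x <;> generalize φ (of 1) = y <;> try generalize φ (of 2) = w
  · cases x <;> cases y <;> rfl
  · cases x <;> cases y <;> rfl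
  · cases x <;> cases y <;> cases w <;> rfl
  · cases x <;> cases y <;> rfl

theorem cap_pow {M : Type*} [Monoid M] {X : M} (h : X ^ 3 = X ^ 2) (n : ℕ) :
    X ^ n = X ^ min 2 n := by
  induction n with
  | zero => rfl
  | succ n ih =>
    rcases Nat.lt_or_ge n 2 with h1 | h1
    · rw [min_eq_right (by omega)]
    · rw [pow_succ, ih, min_eq_left h1, min_eq_left (by omega), ← pow_succ, h]

theorem FM_x3 : (FM.x1 : FM) ^ 3 = FM.x1 ^ 2 := by decide

theorem cap_le (n : ℕ) : min 2 n = 0 ∨ min 2 n = 1 ∨ min 2 n = 2 := by omega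

theorem FM_count {u v : Word} (h : MSat FM (u, v)) (a : ℕ) :
    min 2 ((toList u).count a) = min 2 ((toList v).count a) := by
  have := sat_list h (fun b => if b = a then FM.x1 else 1)
  rw [prod_pow _ a FM.x1 _ (fun _ _ => rfl), prod_pow _ a FM.x1 _ (fun _ _ => rfl),
    cap_pow FM_x3, cap_pow FM_x3 (List.count a (toList v))] at this
  revert this
  rcases cap_le ((toList u).count a) with h1 | h1 | h1 <;>
  rcases cap_le ((toList v).count a) with h2 | h2 | h2 <;> rw [h1, h2] <;> decide

theorem count_split {w u1 u2 : List ℕ} {t : ℕ} (hw : w = u1 ++ t :: u2) (h : w.count t = 1) :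
    t ∉ u1 ∧ t ∉ u2 := by
  subst hw
  simp only [List.count_append, List.count_cons_self] at h
  exact ⟨List.count_eq_zero.1 (by omega), List.count_eq_zero.1 (by omega)⟩

theorem prod_split {M : Type*} [Monoid M] {u1 u2 : List ℕ} {t a : ℕ} (hat : a ≠ t)
    (h1 : t ∉ u1) (h2 : t ∉ u2) (X T : M) :
    ((u1 ++ t :: u2).map (fun b => if b = t then T else if b = a then X else 1)).prod =
      X ^ u1.count a * (T * X ^ u2.count a) := by
  rw [List.map_append, List.map_cons, List.prod_append, List.prod_cons,
    prod_pow _ a X u1, prod_pow _ a X u2]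
  · simp
  · intro b hb; rw [if_neg]; rintro rfl; exact h2 hb
  · intro b hb; rw [if_neg]; rintro rfl; exact h1 hb

theorem FM_pre {u v : Word} (h : MSat FM (u, v)) {a t : ℕ} (hat : a ≠ t)
    {u1 u2 v1 v2 : List ℕ} (hu : toList u = u1 ++ t :: u2) (hv : toList v = v1 ++ t :: v2)
    (hut : (toList u).count t = 1) (hvt : (toList v).count t = 1) :
    min 2 (u1.count a) = min 2 (v1.count a) := by
  have := sat_list h (fun b => if b = t then FM.t0 else if b = a then FM.x1 else 1)
  have hu' := count_split hu hut
  have hv' := count_split hv hvt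
  rw [hu, hv, prod_split hat hu'.1 hu'.2, prod_split hat hv'.1 hv'.2,
    cap_pow FM_x3, cap_pow FM_x3 (List.count a v1), cap_pow FM_x3 (List.count a u2),
    cap_pow FM_x3 (List.count a v2)] at this
  revert this
  rcases cap_le (u1.count a) with h1 | h1 | h1 <;>
  rcases cap_le (v1.count a) with h2 | h2 | h2 <;>
  rcases cap_le (u2.count a) with h3 | h3 | h3 <;>
  rcases cap_le (v2.count a) with h4 | h4 | h4 <;> rw [h1, h2, h3, h4] <;> decide

theorem EM_x3 : (EM.e : EM) ^ 3 = EM.e ^ 2 := by decide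

theorem EM_post {u v : Word} (h : MSat EM (u, v)) {a t : ℕ} (hat : a ≠ t)
    {u1 u2 v1 v2 : List ℕ} (hu : toList u = u1 ++ t :: u2) (hv : toList v = v1 ++ t :: v2)
    (hut : (toList u).count t = 1) (hvt : (toList v).count t = 1) :
    a ∈ u2 ↔ a ∈ v2 := by
  have := sat_list h (fun b => if b = t then EM.t else if b = a then EM.e else 1)
  have hu' := count_split hu hut
  have hv' := count_split hv hvt
  rw [hu, hv, prod_split hat hu'.1 hu'.2, prod_split hat hv'.1 hv'.2,
    cap_pow EM_x3, cap_pow EM_x3 (List.count a v1), cap_pow EM_x3 (List.count a u2),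
    cap_pow EM_x3 (List.count a v2)] at this
  rw [← List.one_le_count_iff, ← List.one_le_count_iff]
  suffices 1 ≤ min 2 (u2.count a) ↔ 1 ≤ min 2 (v2.count a) by omega
  revert this
  rcases cap_le (u1.count a) with h1 | h1 | h1 <;>
  rcases cap_le (v1.count a) with h2 | h2 | h2 <;>
  rcases cap_le (u2.count a) with h3 | h3 | h3 <;>
  rcases cap_le (v2.count a) with h4 | h4 | h4 <;> rw [h1, h2, h3, h4] <;> decide

/-! ### Consequences of `O` -/

theorem O_sq {M : Type*} [Monoid M] (h : SatAll M Oset) (x z : M) :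
    x * z * x * x = x * z * x := by
  have := h (wd [0,2,0,1,0,3,1], wd [0,2,1,0,3,1]) (by simp [Oset])
    (FreeMonoid.lift fun i => if i = 0 then x else if i = 2 then z else 1)
  simpa [wd, hom_ofList, mul_assoc] using this

theorem O_x3 {M : Type*} [Monoid M] (h : SatAll M Oset) (x : M) : x ^ 3 = x ^ 2 := by
  have := O_sq h x 1
  simpa [pow_succ, mul_assoc] using this

def dId : Word × Word := (wd [0,1,0,2,3,0], wd [0,1,0,2,0,3,0])

theorem d_eq {M : Type*} [Monoid M] (h : MSat M dId) (x y z t : M) :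
    x * y * x * z * t * x = x * y * x * z * x * t * x := by
  have := h (FreeMonoid.lift fun i => if i = 0 then x else if i = 1 then y else
    if i = 2 then z else t)
  simpa [dId, wd, hom_ofList, mul_assoc] using this

theorem d_of {M : Type*} [Monoid M] (hO : SatAll M Oset)
    (h : ∀ x z t : M, x ^ 2 * z * t * x = x ^ 2 * z * x * t * x) : MSat M dId := by
  intro φ
  simp only [dId, wd, hom_ofList, List.map_cons, List.map_nil, List.prod_cons, List.prod_nil]
  generalize φ (of 0) = x
  generalize φ (of 1) = y
  generalize φ (of 2) = z
  generalize φ (of 3) = t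
  have h1 := O_sq hO x y
  have h2 := h x z t
  calc x * (y * (x * (z * (t * (x * 1))))) = (x * y * x) * (z * t * x) := by simp [mul_assoc]
    _ = x * y * (x ^ 2 * z * t * x) := by rw [← h1]; simp [mul_assoc, pow_two]
    _ = x * y * x * x * (z * x * t * x) := by rw [h2]; simp [mul_assoc, pow_two]
    _ = _ := by rw [h1]; simp [mul_assoc]

/-- `D`: the identity `xyxztx ≈ xyxzxtx` follows. -/
def DD (u v : Word) : Prop :=
  ∀ (M : Type uM) [Monoid M], SatAll M (Oset ∪ {(u, v)}) → MSat M dId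

theorem pow_ge {M : Type*} [Monoid M] (h : SatAll M Oset) (x : M) {n : ℕ} (hn : 2 ≤ n) :
    x ^ n = x ^ 2 := by
  rw [cap_pow (O_x3 h x), min_eq_left hn]

theorem pow_post {M : Type*} [Monoid M] (h : SatAll M Oset) (x z : M) {n : ℕ} (hn : 1 ≤ n) :
    x ^ 2 * z * x ^ n = x ^ 2 * z * x := by
  induction n, hn using Nat.le_induction with
  | base => simp
  | succ n hn ih =>
    have := O_sq h x (x * z)
    rw [pow_succ x n, ← mul_assoc, ih]
    simpa [pow_two, mul_assoc] using this

theorem prod_split2 {M : Type*} [Monoid M] {u1 u2 u3 : List ℕ} {t s a : ℕ} (hat : a ≠ t)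
    (has : a ≠ s) (hst : s ≠ t) (ht : (u1 ++ t :: (u2 ++ s :: u3)).count t = 1)
    (hs : (u1 ++ t :: (u2 ++ s :: u3)).count s = 1) (X T Y : M) :
    ((u1 ++ t :: (u2 ++ s :: u3)).map
      (fun b => if b = t then T else if b = s then Y else if b = a then X else 1)).prod =
      X ^ u1.count a * T * X ^ u2.count a * Y * X ^ u3.count a := by
  simp only [List.count_append, List.count_cons, beq_self_eq_true, if_true, beq_iff_eq,
    hst, hst.symm, if_false] at ht hs
  have g : ∀ l : List ℕ, l.count t = 0 → l.count s = 0 → ∀ b ∈ l,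
      (if b = t then T else if b = s then Y else if b = a then X else 1) =
        if b = a then X else 1 := by
    intro l h1 h2 b hb
    rw [List.count_eq_zero] at h1 h2
    rw [if_neg (by rintro rfl; exact h1 hb), if_neg (by rintro rfl; exact h2 hb)]
  rw [List.map_append, List.map_cons, List.map_append, List.map_cons, List.prod_append,
    List.prod_cons, List.prod_append, List.prod_cons,
    prod_pow _ a X u1 (g _ (by omega) (by omega)), prod_pow _ a X u2 (g _ (by omega) (by omega)),
    prod_pow _ a X u3 (g _ (by omega) (by omega))]
  simp [hst, mul_assoc]

theorem DD_of {u v : Word} {a t s : ℕ} (hat : a ≠ t) (has : a ≠ s)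
    (hut : (toList u).count t = 1) (hvt : (toList v).count t = 1)
    (hus : (toList u).count s = 1) (hvs : (toList v).count s = 1)
    {u1 u2 u3 v1 v2 v3 : List ℕ} (hu : toList u = u1 ++ t :: (u2 ++ s :: u3))
    (hv : toList v = v1 ++ t :: (v2 ++ s :: v3))
    (c1 : 2 ≤ u1.count a) (c2 : 2 ≤ v1.count a) (c3 : a ∈ u3) (c4 : a ∈ v3)
    (c5 : a ∈ u2) (c6 : a ∉ v2) {M : Type*} [Monoid M] (hO : SatAll M Oset)
    (h : MSat M (u, v)) : MSat M dId := by
  have hst : s ≠ t := by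
    rintro rfl
    rw [hu] at hut
    simp at hut
    omega
  apply d_of hO
  intro x z y
  have := sat_list h (fun b => if b = t then z else if b = s then y else if b = a then x else 1)
  rw [hu] at hut hus
  rw [hv] at hvt hvs
  rw [hu, hv, prod_split2 hat has hst hut hus, prod_split2 hat has hst hvt hvs,
    pow_ge hO x c1, pow_ge hO x c2, List.count_eq_zero.2 c6,
    pow_post hO _ _ (List.one_le_count_iff.2 c5)] at this
  rw [pow_zero, mul_one] at this
  have e1 := pow_post hO x (z * x * y) (List.one_le_count_iff.2 c3)
  have e2 := pow_post hO x (z * y) (List.one_le_count_iff.2 c4)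
  simp only [← mul_assoc] at e1 e2
  rw [e1, e2] at this
  exact this.symm

/-! ### Inflating blocks -/

def Cs (S : Set (Word × Word)) (x y : List ℕ) : Prop :=
  ∀ (M : Type uM) [Monoid M], SatAll M S → ∀ φ : Word →* M, φ (ofList x) = φ (ofList y)

theorem Cs.rfl' {S : Set (Word × Word)} {x : List ℕ} : Cs.{uM} S x x := fun _ _ _ _ => rfl

theorem Cs.trans {S : Set (Word × Word)} {x y z : List ℕ} (h : Cs.{uM} S x y)
    (h' : Cs.{uM} S y z) : Cs.{uM} S x z :=
  fun M _ hM φ => (h M hM φ).trans (h' M hM φ)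

theorem mem_last {a : ℕ} {l : List ℕ} (h : a ∈ l) : ∃ x y, l = x ++ a :: y ∧ a ∉ y := by
  induction l with
  | nil => simp at h
  | cons b l ih =>
    by_cases hl : a ∈ l
    · obtain ⟨x, y, rfl, hy⟩ := ih hl
      exact ⟨b :: x, y, rfl, hy⟩
    · rcases List.mem_cons.1 h with rfl | h
      · exact ⟨[], l, rfl, hl⟩
      · exact absurd h hl

theorem Cs_O {S : Set (Word × Word)} (hS : Oset ⊆ S) (x y z : List ℕ) (a : ℕ) (ha : a ∈ x) :
    Cs.{uM} S (x ++ a :: y) (x ++ a :: a :: y) := by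
  intro M _ hM φ
  obtain ⟨p, q, rfl⟩ := List.append_of_mem ha
  have := O_sq (fun e he => hM e (hS he)) (φ (of a)) (φ (ofList q))
  simp only [ofList_append, ofList_cons, map_mul]
  simp only [← mul_assoc] at this ⊢
  simp only [mul_assoc] at this ⊢
  congr 1
  rw [← mul_assoc (φ (of a)) (φ (of a)), ← mul_assoc (φ (ofList q)), ← mul_assoc (φ (of a))]
  conv_rhs => rw [← mul_assoc (φ (ofList q)), ← mul_assoc (φ (of a)), this]

theorem Cs_d {S : Set (Word × Word)} (hS : dId ∈ S) (x y : List ℕ) (a : ℕ)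
    (ha : 2 ≤ x.count a) (hy : a ∈ y) : Cs.{uM} S (x ++ y) (x ++ a :: y) := by
  intro M _ hM φ
  obtain ⟨p', r, rfl, hr⟩ := mem_last (List.one_le_count_iff.1 (by omega) : a ∈ x)
  obtain ⟨p1, q1, rfl⟩ := List.append_of_mem (List.one_le_count_iff.1 (by
    have := List.count_eq_zero.2 hr
    simp only [List.count_append, List.count_cons_self] at ha
    omega) : a ∈ p')
  obtain ⟨p2, q2, rfl⟩ := List.append_of_mem hy
  have := d_eq (hM _ hS) (φ (of a)) (φ (ofList q1)) (φ (ofList r)) (φ (ofList p2))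
  have h2 := congrArg (fun m => φ (ofList p1) * m * φ (ofList q2)) this
  simpa only [ofList_append, ofList_cons, map_mul, mul_assoc] using h2

def Ok (D : Prop) (k : ℕ → ℕ) (b r : List ℕ) (a : ℕ) : Prop :=
  2 ≤ k a + b.count a ∧ (1 ≤ b.count a ∨ (D ∧ 2 ≤ k a ∧ a ∈ r))

def Inf (S : Set (Word × Word)) (P : ℕ → Prop) (k : ℕ → ℕ) (b b' r : List ℕ) : Prop :=
  ∀ p : List ℕ, (∀ c, ¬ P c → p.count c = k c) → Cs.{uM} S (p ++ (b ++ r)) (p ++ (b' ++ r))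

section
variable {S : Set (Word × Word)} {D : Prop} {P : ℕ → Prop}

theorem ins1 (hS : Oset ⊆ S) (hD : D → dId ∈ S) {k : ℕ → ℕ} {b r : List ℕ} {a : ℕ}
    (ha : ¬ P a) (h : Ok D k b r a) :
    ∃ b' : List ℕ, b'.count a = b.count a + 1 ∧ (∀ c, c ≠ a → b'.count c = b.count c) ∧
      Inf.{uM} S P k b b' r := by
  obtain ⟨h1, h2 | ⟨h2, h3, h4⟩⟩ := h
  · obtain ⟨x, y, rfl, hy⟩ := mem_last (List.one_le_count_iff.1 h2)
    refine ⟨x ++ a :: a :: y, by simp; omega, fun c hc => by simp [hc.symm], ?_⟩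
    intro p hp
    have := hp a ha
    have hy' := List.count_eq_zero.2 hy
    simp only [List.count_append, List.count_cons_self] at h1
    have key := Cs_O.{uM} hS (p ++ x) (y ++ r) [] a (List.one_le_count_iff.1 (by
      rw [List.count_append]; omega))
    simpa using key
  · refine ⟨b ++ [a], by simp, fun c hc => by simp [hc.symm], ?_⟩
    intro p hp
    have := hp a ha
    have key := Cs_d.{uM} (hD h2) (p ++ b) r a (by rw [List.count_append]; omega) h4
    simpa using key

theorem insn (hS : Oset ⊆ S) (hD : D → dId ∈ S) {k : ℕ → ℕ} {b r : List ℕ} {a : ℕ}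
    (ha : ¬ P a) (h : Ok D k b r a) (n : ℕ) :
    ∃ b' : List ℕ, b'.count a = b.count a + n ∧ (∀ c, c ≠ a → b'.count c = b.count c) ∧
      Inf.{uM} S P k b b' r := by
  induction n with
  | zero => exact ⟨b, rfl, fun _ _ => rfl, fun _ _ => Cs.rfl'⟩
  | succ n ih =>
    obtain ⟨b1, h1, h2, h3⟩ := ih
    obtain ⟨b2, g1, g2, g3⟩ := ins1.{uM} (b := b1) hS hD ha (r := r) (k := k)
      ⟨by have := h.1; omega, h.2.imp (fun h => by omega) id⟩
    exact ⟨b2, by omega, fun c hc => (g2 c hc).trans (h2 c hc),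
      fun p hp => (h3 p hp).trans (g3 p hp)⟩

theorem fill (hS : Oset ⊆ S) (hD : D → dId ∈ S) {k : ℕ → ℕ} {b r : List ℕ} (g : ℕ → ℕ)
    (hg : ∀ a, b.count a = g a ∨ (¬ P a ∧ b.count a ≤ g a ∧ Ok D k b r a)) (L : List ℕ) :
    ∃ b' : List ℕ, (∀ a ∈ L, b'.count a = g a) ∧ (∀ a, a ∉ L → b'.count a = b.count a) ∧
      Inf.{uM} S P k b b' r := by
  induction L with
  | nil => exact ⟨b, by simp, by simp, fun _ _ => Cs.rfl'⟩
  | cons a L ih =>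
    obtain ⟨b1, h1, h2, h3⟩ := ih
    by_cases haL : a ∈ L
    · exact ⟨b1, by simp_all, by simp_all, h3⟩
    · have e := h2 a haL
      rcases hg a with hg | ⟨hP, hl, hok⟩
      · refine ⟨b1, ?_, fun c hc => h2 c (by simp_all), h3⟩
        intro c hc
        rcases List.mem_cons.1 hc with rfl | hc
        · rw [e, hg]
        · exact h1 c hc
      · obtain ⟨b2, g1, g2, g3⟩ := insn.{uM} (b := b1) hS hD hP (r := r) (k := k)
          (by unfold Ok at hok ⊢; rw [e]; exact hok) (g a - b.count a)
        refine ⟨b2, ?_, ?_, fun p hp => (h3 p hp).trans (g3 p hp)⟩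
        · intro c hc
          by_cases hca : c = a
          · subst hca; omega
          · rw [g2 c hca]; exact h1 c (by simp_all)
        · intro c hc
          rw [g2 c (by rintro rfl; simp at hc)]
          exact h2 c (by simp_all)

theorem block (hS : Oset ⊆ S) (hD : D → dId ∈ S) {k : ℕ → ℕ} {b c r s : List ℕ}
    (h : ∀ a, b.count a = c.count a ∨ (¬ P a ∧ Ok D k b r a ∧ Ok D k c s a)) :
    ∃ b' c' : List ℕ, (∀ a, b'.count a = c'.count a) ∧
      (∀ a, b'.count a = max (b.count a) (c.count a)) ∧
      Inf.{uM} S P k b b' r ∧ Inf.{uM} S P k c c' s := by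
  obtain ⟨b', b1, b2, b3⟩ := fill.{uM} (r := r) (b := b) (k := k) (P := P) hS hD
    (fun a => max (b.count a) (c.count a))
    (fun a => by rcases h a with h | h
                 · left; omega
                 · right; exact ⟨h.1, by omega, h.2.1⟩) (b ++ c)
  obtain ⟨c', c1, c2, c3⟩ := fill.{uM} (r := s) (b := c) (k := k) (P := P) hS hD
    (fun a => max (b.count a) (c.count a))
    (fun a => by rcases h a with h | h
                 · left; omega
                 · right; exact ⟨h.1, by omega, h.2.2⟩) (b ++ c)
  have hb : ∀ a, b'.count a = max (b.count a) (c.count a) := by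
    intro a
    by_cases ha : a ∈ b ++ c
    · exact b1 a ha
    · rw [b2 a ha]
      simp only [List.mem_append, not_or] at ha
      rw [List.count_eq_zero.2 ha.1, List.count_eq_zero.2 ha.2]; rfl
  have hc : ∀ a, c'.count a = max (b.count a) (c.count a) := by
    intro a
    by_cases ha : a ∈ b ++ c
    · exact c1 a ha
    · rw [c2 a ha]
      simp only [List.mem_append, not_or] at ha
      rw [List.count_eq_zero.2 ha.1, List.count_eq_zero.2 ha.2]; rfl
  exact ⟨b', c', fun a => by rw [hb, hc], hb, b3, c3⟩

theorem first_P {l : List ℕ} (h : ∃ t ∈ l, P t) :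
    ∃ b t r, l = b ++ t :: r ∧ P t ∧ ∀ x ∈ b, ¬ P x := by
  induction l with
  | nil => simp at h
  | cons a l ih =>
    by_cases ha : P a
    · exact ⟨[], a, l, rfl, ha, by simp⟩
    · obtain ⟨t, ht, hP⟩ := h
      rcases List.mem_cons.1 ht with rfl | ht
      · exact absurd hP ha
      · obtain ⟨b, t, r, rfl, h1, h2⟩ := ih ⟨t, ht, hP⟩
        exact ⟨a :: b, t, r, rfl, h1, by simpa using ⟨ha, h2⟩⟩

/-- Conclusion of the main induction. -/
def Concl (S : Set (Word × Word)) (P : ℕ → Prop) (k : ℕ → ℕ) (u v : List ℕ) : Prop :=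
  ∃ b0 ps c0 qs, ps.map Prod.fst = qs.map Prod.fst ∧
    List.Forall₂ (fun b c : List ℕ => ∀ a, b.count a = c.count a)
      (b0 :: ps.map Prod.snd) (c0 :: qs.map Prod.snd) ∧
    (∀ p ∈ ps, P p.1) ∧ (∀ p ∈ qs, P p.1) ∧
    (∀ a ∈ b0, ¬ P a) ∧ (∀ a ∈ c0, ¬ P a) ∧
    (∀ p ∈ ps, ∀ a ∈ p.2, ¬ P a) ∧ (∀ p ∈ qs, ∀ a ∈ p.2, ¬ P a) ∧
    (∀ a, P a → (assemble b0 ps).count a = u.count a) ∧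
    (∀ a, P a → (assemble c0 qs).count a = v.count a) ∧
    (∀ a, ¬ P a → min 2 (k a + (assemble b0 ps).count a) = min 2 (k a + u.count a)) ∧
    (∀ a, ¬ P a → min 2 (k a + (assemble c0 qs).count a) = min 2 (k a + v.count a)) ∧
    (∀ p : List ℕ, (∀ c, ¬ P c → p.count c = k c) → Cs.{uM} S (p ++ u) (p ++ assemble b0 ps)) ∧
    (∀ p : List ℕ, (∀ c, ¬ P c → p.count c = k c) → Cs.{uM} S (p ++ v) (p ++ assemble c0 qs))

/-- One block: the dichotomy. -/
theorem dich {k : ℕ → ℕ} {b c r s : List ℕ} {a : ℕ} (ha : ¬ P a)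
    (h1 : min 2 (k a + b.count a) = min 2 (k a + c.count a))
    (h2 : (a ∈ b ∨ a ∈ r) ↔ (a ∈ c ∨ a ∈ s)) (h3 : a ∈ r ↔ a ∈ s)
    (h4 : ¬ D → 2 ≤ k a → a ∈ r → (a ∈ b ↔ a ∈ c)) :
    b.count a = c.count a ∨ (¬ P a ∧ Ok D k b r a ∧ Ok D k c s a) := by
  by_cases e : b.count a = c.count a
  · exact Or.inl e
  · right
    unfold Ok
    rw [← List.one_le_count_iff (l := b), ← List.one_le_count_iff (l := c)] at h2 h4
    refine ⟨ha, ⟨by omega, ?_⟩, ⟨by omega, ?_⟩⟩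
    · by_cases hb : 1 ≤ b.count a
      · exact Or.inl hb
      · right
        have hc : 1 ≤ c.count a := by omega
        have hk : 2 ≤ k a := by omega
        have hr : a ∈ r := by tauto
        exact ⟨by tauto, hk, hr⟩
    · by_cases hb : 1 ≤ c.count a
      · exact Or.inl hb
      · right
        have hc : 1 ≤ b.count a := by omega
        have hk : 2 ≤ k a := by omega
        have hr : a ∈ s := by tauto
        exact ⟨by tauto, hk, hr⟩

set_option maxHeartbeats 1000000 in
theorem main_ind (hS : Oset ⊆ S) (hD : D → dId ∈ S) (n : ℕ) : ∀ (k : ℕ → ℕ) (u v : List ℕ),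
    u.length ≤ n →
    (∀ a, P a → u.count a ≤ 1) → (∀ a, P a → v.count a ≤ 1) →
    (∀ a, ¬ P a → min 2 (k a + u.count a) = min 2 (k a + v.count a)) →
    (∀ t u1 u2 v1 v2, P t → u = u1 ++ t :: u2 → v = v1 ++ t :: v2 →
      (∀ a, ¬ P a → min 2 (k a + u1.count a) = min 2 (k a + v1.count a)) ∧
      (∀ a, P a → (a ∈ u1 ↔ a ∈ v1)) ∧ (∀ a, a ∈ u2 ↔ a ∈ v2)) →
    (∀ a, a ∈ u ↔ a ∈ v) →
    (¬ D → ∀ t u1 u2 v1 v2, P t → u = u1 ++ t :: u2 → v = v1 ++ t :: v2 →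
      ∀ a, ¬ P a → 2 ≤ k a → a ∈ u2 → (a ∈ u1 ↔ a ∈ v1)) →
    (¬ D → ∀ t s u1 u2 u3 v1 v2 v3, P t → P s → u = u1 ++ t :: (u2 ++ s :: u3) →
      v = v1 ++ t :: (v2 ++ s :: v3) →
      ∀ a, ¬ P a → 2 ≤ k a + u1.count a → a ∈ u3 → (a ∈ u2 ↔ a ∈ v2)) →
    Concl.{uM} S P k u v := by
  induction n with
  | zero => 
    intro k u v hn hu hv h1 h1' h2 h3 h4
    have e : u = [] := List.length_eq_zero_iff.1 (by omega)
    subst e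
    have e : v = [] := by
      apply List.eq_nil_iff_forall_not_mem.2
      intro a ha
      simpa using (h2 a).2 ha
    subst e
    refine ⟨[], [], [], [], ?_⟩
    simp [assemble, Cs.rfl']
  | succ n ih =>
    intro k u v hn hu hv h1 h1' h2 h3 h4
    by_cases hex : ∃ t ∈ u, P t
    · obtain ⟨b, t, u2, rfl, hPt, hb⟩ := first_P hex
      obtain ⟨c, v2, rfl⟩ := List.append_of_mem ((h2 t).1 (by simp))
      obtain ⟨k1, k2, k3⟩ := h1' t b u2 c v2 hPt rfl rfl
      have hc : ∀ x ∈ c, ¬ P x := fun x hx hPx => hb x ((k2 x hPx).2 hx) hPx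
      have htu : t ∉ u2 := by
        have := hu t hPt
        simp only [List.count_append, List.count_cons_self] at this
        exact List.count_eq_zero.1 (by omega)
      have htv : t ∉ v2 := fun h => htu ((k3 t).2 h)
      have hne : ∀ a, ¬ P a → a ≠ t := by rintro a ha rfl; exact ha hPt
      have hcnt : ∀ (x y : List ℕ) a, ¬ P a → (x ++ t :: y).count a = x.count a + y.count a := by
        intro x y a ha
        simp [(hne a ha).symm]
      have hbl : ∀ a, b.count a = c.count a ∨
          (¬ P a ∧ Ok D k b (t :: u2) a ∧ Ok D k c (t :: v2) a) := by
        intro a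
        by_cases ha : P a
        · left
          rw [List.count_eq_zero.2 (fun h => hb a h ha), List.count_eq_zero.2 (fun h => hc a h ha)]
        · have n1 := hne a ha
          refine dich ha (k1 a ha) ?_ ?_ ?_
          · simpa using h2 a
          · simpa [n1] using k3 a
          · intro hnD hk har
            exact h3 hnD t b u2 c v2 hPt rfl rfl a ha hk (by simpa [n1] using har)
      obtain ⟨b', c', e1, e2, e3, e4⟩ := block.{uM} hS hD hbl
      have hb0 : ∀ a, P a → b.count a = 0 := fun a ha => List.count_eq_zero.2 (fun h => hb a h ha)
      have hc0 : ∀ a, P a → c.count a = 0 := fun a ha => List.count_eq_zero.2 (fun h => hc a h ha)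
      have hk' : ∀ a, ¬ P a → min 2 (k a + b'.count a) = min 2 (k a + b.count a) := by
        intro a ha
        have := k1 a ha
        rw [e2]; omega
      have hb'P : ∀ a, P a → b'.count a = 0 := by
        intro a ha; rw [e2, hb0 a ha, hc0 a ha]; rfl
      have hb' : ∀ a ∈ b', ¬ P a := fun a h ha => List.count_eq_zero.1 (hb'P a ha) h
      have hc' : ∀ a ∈ c', ¬ P a := fun a h ha =>
        List.count_eq_zero.1 ((e1 a).symm.trans (hb'P a ha)) h
      have hI := ih (fun a => k a + b'.count a) u2 v2 (by simp at hn; omega)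
        (fun a ha => le_trans (by simp [List.count_cons]; omega) (hu a ha))
        (fun a ha => le_trans (by simp [List.count_cons]; omega) (hv a ha))
        (fun a ha => by
          have z1 := h1 a ha
          have z2 := hk' a ha
          have z3 := k1 a ha
          rw [hcnt _ _ _ ha, hcnt _ _ _ ha] at z1
          omega)
        (fun s u1 u3 v1 v3 hs eu ev => by
          obtain ⟨m1, m2, m3⟩ := h1' s (b ++ t :: u1) u3 (c ++ t :: v1) v3 hs
            (by simp [eu]) (by simp [ev])
          refine ⟨?_, ?_, m3⟩
          · intro a ha
            have z1 := m1 a ha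
            have z2 := hk' a ha
            have z3 := k1 a ha
            rw [hcnt _ _ _ ha, hcnt _ _ _ ha] at z1
            omega
          · intro a ha
            by_cases hat : a = t
            · subst hat
              rw [eu, List.mem_append, not_or] at htu
              rw [ev, List.mem_append, not_or] at htv
              exact iff_of_false htu.1 htv.1
            · have := m2 a ha
              have q1 : a ∉ b := fun h => hb a h ha
              have q2 : a ∉ c := fun h => hc a h ha
              simpa [hat, q1, q2] using this)
        k3
        (fun hnD s u1 u3 v1 v3 hs eu ev a ha hk hau => 
          h4 hnD t s b u1 u3 c v1 v3 hPt hs (by simp [eu]) (by simp [ev]) a ha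
            (by have := hk' a ha; omega) hau)
        (fun hnD s s' u1 u3 u4 v1 v3 v4 hs hs' eu ev a ha hk hau =>
          h4 hnD s s' (b ++ t :: u1) u3 u4 (c ++ t :: v1) v3 v4 hs hs'
            (by simp [eu]) (by simp [ev]) a ha
            (by have := hk' a ha; rw [hcnt _ _ _ ha]; omega) hau)
      obtain ⟨b0, ps, c0, qs, f1, f2, f3, f4, f5, f6, f7, f8, f9, f10, f11, f12, f13, f14⟩ := hI
      have as : ∀ x y (zs : List (ℕ × List ℕ)),
          assemble x ((t, y) :: zs) = x ++ t :: assemble y zs := by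
        intro x y zs; simp [assemble]
      refine ⟨b', (t, b0) :: ps, c', (t, c0) :: qs, ?_, ?_, ?_, ?_, hb', hc', ?_, ?_, ?_, ?_,
        ?_, ?_, ?_, ?_⟩
      · simp [f1]
      · exact List.Forall₂.cons e1 f2
      · simpa [hPt] using f3
      · simpa [hPt] using f4
      · intro p hp
        rcases List.mem_cons.1 hp with rfl | hp
        · exact f5
        · exact f7 p hp
      · intro p hp
        rcases List.mem_cons.1 hp with rfl | hp
        · exact f6
        · exact f8 p hp
      · intro a ha
        rw [as]
        simp only [List.count_append, List.count_cons, f9 a ha, hb'P a ha, hb0 a ha]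
      · intro a ha
        rw [as]
        simp only [List.count_append, List.count_cons, f10 a ha, ← e1, hb'P a ha, hc0 a ha]
      · intro a ha
        rw [as, hcnt _ _ _ ha, hcnt _ _ _ ha]
        have z1 := f11 a ha; beta_reduce at z1
        have z2 := hk' a ha
        omega
      · intro a ha
        rw [as, hcnt _ _ _ ha, hcnt _ _ _ ha, ← e1]
        have z1 := f12 a ha; beta_reduce at z1
        have z2 := hk' a ha
        have z3 := k1 a ha
        omega
      · intro p hp
        rw [as]
        refine (e3 p hp).trans ?_
        have := f13 (p ++ (b' ++ [t])) (fun a ha => by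
          simp [hp a ha, (hne a ha).symm])
        simpa using this
      · intro p hp
        rw [as]
        refine (e4 p hp).trans ?_
        have := f14 (p ++ (c' ++ [t])) (fun a ha => by
          simp [hp a ha, (hne a ha).symm, e1])
        simpa using this
    · have hu' : ∀ a ∈ u, ¬ P a := fun a ha hP => hex ⟨a, ha, hP⟩
      have hv' : ∀ a ∈ v, ¬ P a := fun a ha hP => hex ⟨a, (h2 a).2 ha, hP⟩
      have hu0 : ∀ a, P a → u.count a = 0 := fun a ha => List.count_eq_zero.2 (fun h => hu' a h ha)
      have hv0 : ∀ a, P a → v.count a = 0 := fun a ha => List.count_eq_zero.2 (fun h => hv' a h ha)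
      have hbl : ∀ a, u.count a = v.count a ∨ (¬ P a ∧ Ok D k u [] a ∧ Ok D k v [] a) := by
        intro a
        by_cases ha : P a
        · left; rw [hu0 a ha, hv0 a ha]
        · exact dich ha (h1 a ha) (by simpa using h2 a) (by simp) (by simp)
      obtain ⟨b', c', e1, e2, e3, e4⟩ := block.{uM} hS hD hbl
      have hb'P : ∀ a, P a → b'.count a = 0 := by
        intro a ha; rw [e2, hu0 a ha, hv0 a ha]; rfl
      have as : ∀ x, assemble x [] = x := by intro x; simp [assemble]
      refine ⟨b', [], c', [], rfl, List.Forall₂.cons e1 List.Forall₂.nil, by simp, by simp,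
        fun a h ha => List.count_eq_zero.1 (hb'P a ha) h,
        fun a h ha => List.count_eq_zero.1 ((e1 a).symm.trans (hb'P a ha)) h,
        by simp, by simp, ?_, ?_, ?_, ?_, ?_, ?_⟩
      · intro a ha; rw [as, hb'P a ha, hu0 a ha]
      · intro a ha; rw [as, ← e1, hb'P a ha, hv0 a ha]
      · intro a ha; rw [as, e2]; have := h1 a ha; omega
      · intro a ha; rw [as, ← e1, e2]; have := h1 a ha; omega
      · intro p hp; rw [as]; simpa using e3 p hp
      · intro p hp; rw [as]; simpa using e4 p hp

end

theorem exists_wb (u v : Word)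
    (hF : ∀ (M : Type uM) [Monoid M], SatAll M F0set → MSat M (u, v))
    (hE : ∀ (M : Type uM) [Monoid M], SatAll M Eset → MSat M (u, v))
    (S : Set (Word × Word)) (hS : Oset ⊆ S) (hD : DD.{uM} u v → dId ∈ S) :
    ∃ u' v' : Word, WellBalanced (toList u') (toList v') ∧
      Cs.{uM} S (toList u) (toList u') ∧ Cs.{uM} S (toList v) (toList v') := by
  have sF : MSat FM (u, v) := sat_down (hF _ (sat_ulift FM_sat))
  have sE : MSat EM (u, v) := sat_down (hE _ (sat_ulift EM_sat))
  have hA := FM_count sF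
  have hPv : ∀ t, (toList u).count t = 1 → (toList v).count t = 1 := by
    intro t ht; have := hA t; omega
  have hsp : ∀ t u1 u2 v1 v2, (toList u).count t = 1 → toList u = u1 ++ t :: u2 →
      toList v = v1 ++ t :: v2 →
      (∀ a, a ≠ t → min 2 (u1.count a) = min 2 (v1.count a)) ∧ (∀ a, a ∈ u2 ↔ a ∈ v2) := by
    intro t u1 u2 v1 v2 ht eu ev
    refine ⟨fun a ha => FM_pre sF ha eu ev ht (hPv t ht), fun a => ?_⟩
    by_cases hat : a = t
    · subst hat
      have := (count_split eu ht).2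
      have := (count_split ev (hPv a ht)).2
      tauto
    · exact EM_post sE hat eu ev ht (hPv t ht)
  have hM := main_ind.{uM} (P := fun a => (toList u).count a = 1) hS hD (toList u).length
    (fun _ => 0) (toList u) (toList v) le_rfl
    (fun a ha => ha.le) (fun a ha => (hPv a ha).le)
    (fun a ha => by simpa using hA a)
    (fun t u1 u2 v1 v2 ht eu ev => by
      obtain ⟨q1, q2⟩ := hsp t u1 u2 v1 v2 ht eu ev
      refine ⟨fun a ha => ?_, fun a ha => ?_, q2⟩
      · have := q1 a (by rintro rfl; exact ha ht)
        simpa using this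
      · by_cases hat : a = t
        · subst hat
          have := (count_split eu ht).1
          have := (count_split ev (hPv a ht)).1
          tauto
        · have := q1 a hat
          rw [← List.one_le_count_iff, ← List.one_le_count_iff]
          omega)
    (fun a => by
      have := hA a
      rw [← List.one_le_count_iff, ← List.one_le_count_iff]
      omega)
    (by intros; omega)
    (by
      intro hnD t s u1 u2 u3 v1 v2 v3 ht hs eu ev a ha hk hau
      have hat : a ≠ t := by rintro rfl; exact ha ht
      have has : a ≠ s := by rintro rfl; exact ha hs
      obtain ⟨q1, -⟩ := hsp t u1 _ v1 _ ht eu ev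
      obtain ⟨-, q2⟩ := hsp s (u1 ++ t :: u2) u3 (v1 ++ t :: v2) v3 hs (by simp [eu]) (by simp [ev])
      have hk1 : 2 ≤ u1.count a := by simpa using hk
      have hk2 : 2 ≤ v1.count a := by have := q1 a hat; omega
      have hav := (q2 a).1 hau
      by_contra hcon
      apply hnD
      intro M _ hM
      have hO : SatAll M Oset := fun e he => hM e (Or.inl he)
      have huv : MSat M (u, v) := hM _ (Or.inr rfl)
      by_cases c5 : a ∈ u2
      · have c6 : a ∉ v2 := by tauto
        exact DD_of hat has ht (hPv t ht) hs (hPv s hs) eu ev hk1 hk2 hau hav c5 c6 hO huv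
      · have c6 : a ∈ v2 := by tauto
        exact DD_of hat has (hPv t ht) ht (hPv s hs) hs ev eu hk2 hk1 hav hau c6 c5 hO
          (fun φ => (huv φ).symm))
  obtain ⟨b0, ps, c0, qs, f1, f2, f3, f4, f5, f6, f7, f8, f9, f10, f11, f12, f13, f14⟩ := hM
  have big : ∀ a, ¬ (toList u).count a = 1 → a ∈ assemble b0 ps →
      2 ≤ (assemble b0 ps).count a := by
    intro a ha hm
    have h1 := f11 a ha
    simp only [Nat.zero_add] at h1
    have h2 := List.one_le_count_iff.2 hm
    omega
  have big' : ∀ a, ¬ (toList u).count a = 1 → a ∈ assemble c0 qs →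
      2 ≤ (assemble c0 qs).count a := by
    intro a ha hm
    have h1 := f12 a ha
    simp only [Nat.zero_add] at h1
    have h2 := List.one_le_count_iff.2 hm
    have h3 := hA a
    omega
  refine ⟨ofList (assemble b0 ps), ofList (assemble c0 qs),
    ⟨b0, ps, c0, qs, ⟨rfl, ?_, ?_, ?_⟩, ⟨rfl, ?_, ?_, ?_⟩, f1, f2⟩, ?_, ?_⟩
  · intro p hp; exact (f9 _ (f3 p hp)).trans (f3 p hp)
  · intro a ha; exact big a (f5 a ha) (by simp [assemble, ha])
  · intro p hp a ha
    refine big a (f7 p hp a ha) ?_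
    simp only [assemble, List.mem_append, List.mem_flatten, List.mem_map]
    exact Or.inr ⟨_, ⟨p, hp, rfl⟩, by simp [ha]⟩
  · intro p hp; exact (f10 _ (f4 p hp)).trans (hPv _ (f4 p hp))
  · intro a ha; exact big' a (f6 a ha) (by simp [assemble, ha])
  · intro p hp a ha
    refine big' a (f8 p hp a ha) ?_
    simp only [assemble, List.mem_append, List.mem_flatten, List.mem_map]
    exact Or.inr ⟨_, ⟨p, hp, rfl⟩, by simp [ha]⟩
  · simpa using f13 [] (by simp)
  · simpa using f14 [] (by simp)

theorem varEq_of {u v u' v' : Word} {S : Set (Word × Word)}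
    (h1 : Cs.{uM} S (toList u) (toList u')) (h2 : Cs.{uM} S (toList v) (toList v'))
    (hOS : Oset ⊆ S)
    (hS : ∀ (M : Type uM) [Monoid M], SatAll M (Oset ∪ {(u, v)}) → SatAll M S)
    {M : Type uM} [Monoid M] :
    SatAll M (Oset ∪ {(u, v)}) ↔ SatAll M S ∧ MSat M (u', v') := by
  constructor
  · intro h
    have hs := hS M h
    refine ⟨hs, fun φ => ?_⟩
    have a1 := h1 M hs φ
    have a2 := h2 M hs φ
    have a3 : φ u = φ v := h (u, v) (Or.inr rfl) φ
    exact a1.symm.trans (a3.trans a2)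
  · rintro ⟨hs, h⟩ e (he | he)
    · exact hs e (hOS he)
    · rw [Set.mem_singleton_iff] at he
      subst he
      intro φ
      have a1 := h1 M hs φ
      have a2 := h2 M hs φ
      have a3 : φ u' = φ v' := h φ
      exact a1.trans (a3.trans a2.symm)

end RWB


/-- Reduction to well-balanced identities: if `u ≈ v` holds in `F₀ ∨ E` then, modulo
the defining identities of `O`, it is equivalent either to a well-balanced identity
`u' ≈ v'` or to a well-balanced identity `u' ≈ v'` together with `xyxztx ≈ xyxzxtx`. -/
theorem reduction_to_well_balanced (u v : Word)
    (hF : ∀ (M : Type uM) [Monoid M], SatAll M F0set → MSat M (u, v))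
    (hE : ∀ (M : Type uM) [Monoid M], SatAll M Eset → MSat M (u, v)) :
    ∃ u' v' : Word, WellBalanced (toList u') (toList v') ∧
      (VarEq.{uM} (Oset ∪ {(u, v)}) (Oset ∪ {(u', v')}) ∨
       VarEq.{uM} (Oset ∪ {(u, v)})
         (Oset ∪ {(u', v'), (wd [0,1,0,2,3,0], wd [0,1,0,2,0,3,0])})) := by
  by_cases hD : RWB.DD.{uM} u v
  · obtain ⟨u', v', hw, h1, h2⟩ := RWB.exists_wb u v hF hE (Oset ∪ {RWB.dId})
      Set.subset_union_left (fun _ => Or.inr rfl)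
    refine ⟨u', v', hw, Or.inr ?_⟩
    intro M _
    rw [RWB.varEq_of h1 h2 Set.subset_union_left]
    · constructor
      · rintro ⟨hs, h⟩ e (he | he | he)
        · exact hs e (Or.inl he)
        · subst he; exact h
        · exact hs e (Or.inr he)
      · intro h
        refine ⟨?_, h _ (Or.inr (Or.inl rfl))⟩
        rintro e (he | he)
        · exact h e (Or.inl he)
        · exact h e (Or.inr (Or.inr he))
    · rintro N _ hN e (he | he)
      · exact hN e (Or.inl he)
      · rw [Set.mem_singleton_iff] at he
        subst he
        exact hD N hN
  · obtain ⟨u', v', hw, h1, h2⟩ := RWB.exists_wb u v hF hE Oset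
      (Set.Subset.refl _) (fun h => absurd h hD)
    refine ⟨u', v', hw, Or.inl ?_⟩
    intro M _
    rw [RWB.varEq_of h1 h2 (Set.Subset.refl _)]
    · constructor
      · rintro ⟨hs, h⟩ e (he | he)
        · exact hs e he
        · rw [Set.mem_singleton_iff] at he; subst he; exact h
      · intro h
        exact ⟨fun e he => h e (Or.inl he), h _ (Or.inr rfl)⟩
    · exact fun N _ hN e he => hN e (Or.inl he)
end

section
/- Let V = Mod(Σ) be a variety of monoids that contains every monoid of F₀ and every monoid of E (i.e., every identity of Σ holds both in all monoids satisfying the defining identities of F₀ and in all monoids satisfying the defining identities of E) and that satisfies the identity xyx ≈ xyx². If V does not contain the variety J (i.e., some monoid satisfying the defining identities of J fails some identity of Σ), then V satisfies the identity xzxyxty ≈ xzyxty. -/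
open FreeMonoid

universe uM

/-! ### Evaluation of words and consequences of the identities of `J` -/

/-- The elementwise form of the defining identities of `J`. -/
structure JM (M : Type*) [Monoid M] : Prop where
  j1 : ∀ x y : M, x * y * x = x * y * x * x
  j2 : ∀ x y : M, x * x * y * y = y * y * x * x
  j3 : ∀ x y z : M, x * y * z * x * y = y * x * z * x * y
  j4 : ∀ x y z t : M, x * y * x * z * t * x = x * y * x * z * x * t * x
  jn : ∀ (x : M) (p : List (M × M)) (q : List M), q.Perm (p.map Prod.snd) →
    x * q.prod * x * (p.map fun a => a.1 * a.2).prod =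
      x * x * q.prod * (p.map fun a => a.1 * a.2).prod

theorem perm_index {M : Type*} (p q : List M) (h : q.Perm p) :
    ∃ π : Equiv.Perm (Fin p.length), q = (List.finRange p.length).map (fun i => p.get (π i)) := by
  classical
  have hl := h.length_eq
  let e : Fin p.length ≃ Fin p.length :=
    (finCongr hl.symm).trans (Equiv.ofBijective h.idxBij ⟨h.idxBij_injective, h.idxBij_surjective⟩)
  refine ⟨e, ?_⟩
  apply List.ext_getElem
  · simp [hl]
  · intro i h1 h2
    have := h.getElem_idxBij_eq_getElem ⟨i, h1⟩
    simp only [List.getElem_map, List.getElem_finRange, List.get_eq_getElem]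
    rw [← this]
    rfl

theorem jm_of_sat {M : Type*} [Monoid M] (h : SatAll M Jset) : JM M := by
  have key : ∀ a b : List ℕ, (wd a, wd b) ∈ Jset → ∀ g : ℕ → M,
      (a.map g).prod = (b.map g).prod := by
    intro a b hab g
    have := h _ hab (FreeMonoid.lift g)
    simpa [wd, FreeMonoid.lift_apply] using this
  refine ⟨?_, ?_, ?_, ?_, ?_⟩
  · intro x y
    have := key [0,1,0] [0,1,0,0] (by simp [Jset]) (fun n => if n = 0 then x else y)
    simpa [mul_assoc] using this
  · intro x y
    have := key [0,0,1,1] [1,1,0,0] (by simp [Jset]) (fun n => if n = 0 then x else y)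
    simpa [mul_assoc] using this
  · intro x y z
    have := key [0,1,2,0,1] [1,0,2,0,1] (by simp [Jset])
      (fun n => if n = 0 then x else if n = 1 then y else z)
    simpa [mul_assoc] using this
  · intro x y z t
    have := key [0,1,0,2,3,0] [0,1,0,2,0,3,0] (by simp [Jset])
      (fun n => if n = 0 then x else if n = 1 then y else if n = 2 then z else t)
    simpa [mul_assoc] using this
  · intro x p q hq
    obtain ⟨π', hπ'⟩ := perm_index _ _ hq
    by_cases hn : p.length = 0
    · have : p = [] := List.length_eq_zero_iff.mp hn
      subst this
      simp at hq
      subst hq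
      simp
    let π : Equiv.Perm (Fin p.length) :=
      (finCongr (by simp)).trans (π'.trans (finCongr (by simp)))
    have hq2 : q = (List.finRange p.length).map (fun i => (p.get (π i)).2) := by
      rw [hπ']
      apply List.ext_getElem
      · simp
      · intro i h1 h2
        simp [π]
    let g : ℕ → M := fun k => if k = 0 then x else
      if hk : (k - 1) / 2 < p.length then
        (if k % 2 = 1 then (p.get ⟨(k-1)/2, hk⟩).2 else (p.get ⟨(k-1)/2, hk⟩).1) else 1
    have g1 : ∀ i : Fin p.length, g (2 * (i : ℕ) + 1) = (p.get i).2 := by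
      intro i
      have h1 : (2 * (i : ℕ) + 1 - 1) / 2 = i := by omega
      simp [g, i.2, Nat.add_mod]
    have g2 : ∀ i : Fin p.length, g (2 * (i : ℕ) + 2) = (p.get i).1 := by
      intro i
      have h1 : (2 * (i : ℕ) + 1) / 2 = i := by omega
      simp [g, h1, i.2]
    have g0 : g 0 = x := by simp [g]
    have := h (Jscheme p.length π) (Or.inr ⟨p.length, by omega, π, rfl⟩) (FreeMonoid.lift g)
    simp only [Jscheme, map_mul, map_list_prod, List.map_map, FreeMonoid.lift_eval_of, g0,
      Function.comp_def, g1] at this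
    rw [← hq2] at this
    simp only [List.bind_eq_flatMap, List.pure_def, ← List.map_eq_flatMap] at this
    simp only [List.map_map, Function.comp_def, g1, g2] at this
    have hp : (p.map fun a => a.1 * a.2) =
        (List.finRange p.length).map (fun i => (p.get i).1 * (p.get i).2) := by
      apply List.ext_getElem <;> simp
    rw [hp]
    exact this

/-- Value of a list of letters. -/
def ev {M : Type*} [Monoid M] (f : ℕ → M) (l : List ℕ) : M := (l.map f).prod

section evs
variable {M : Type*} [Monoid M] (f : ℕ → M)

@[simp] theorem ev_nil : ev f [] = 1 := rfl
@[simp] theorem ev_cons (a : ℕ) (l : List ℕ) : ev f (a :: l) = f a * ev f l := by simp [ev]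
@[simp] theorem ev_append (a b : List ℕ) : ev f (a ++ b) = ev f a * ev f b := by simp [ev]

end evs

/-- `s` has an occurrence followed by an occurrence of `y`. -/
def Pr (s y : ℕ) : List ℕ → Prop
  | [] => False
  | c :: l => (c = s ∧ y ∈ l) ∨ Pr s y l

@[simp] theorem pr_nil (s y : ℕ) : Pr s y [] ↔ False := Iff.rfl
@[simp] theorem pr_cons (s y c : ℕ) (l : List ℕ) :
    Pr s y (c :: l) ↔ (c = s ∧ y ∈ l) ∨ Pr s y l := Iff.rfl
@[simp] theorem pr_append (s y : ℕ) (a b : List ℕ) :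
    Pr s y (a ++ b) ↔ Pr s y a ∨ (s ∈ a ∧ y ∈ b) ∨ Pr s y b := by
  induction a with
  | nil => simp
  | cons c a ih => simp [ih]; grind

theorem pr_mem {s y : ℕ} {l : List ℕ} (h : Pr s y l) : s ∈ l ∧ y ∈ l := by
  induction l with
  | nil => simp at h
  | cons c a ih => simp at h; grind

/-- The part of a word before the first occurrence of `s`. -/
def bef (s : ℕ) : List ℕ → List ℕ
  | [] => []
  | c :: l => if c = s then [] else c :: bef s l

@[simp] theorem bef_nil (s : ℕ) : bef s [] = [] := rfl
theorem bef_cons (s c : ℕ) (l : List ℕ) :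
    bef s (c :: l) = if c = s then [] else c :: bef s l := rfl
@[simp] theorem bef_cons_self (s : ℕ) (l : List ℕ) : bef s (s :: l) = [] := by simp [bef_cons]
theorem bef_append_mem {s : ℕ} {a : List ℕ} (h : s ∈ a) (b : List ℕ) :
    bef s (a ++ b) = bef s a := by
  induction a with
  | nil => simp at h
  | cons c a ih => simp only [List.cons_append, bef_cons]; grind
theorem bef_append_not_mem {s : ℕ} {a : List ℕ} (h : s ∉ a) (b : List ℕ) :
    bef s (a ++ b) = a ++ bef s b := by
  induction a with
  | nil => simp
  | cons c a ih => simp only [List.cons_append, bef_cons]; grind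
theorem bef_split {s : ℕ} {w : List ℕ} (h : s ∈ w) : ∃ r, w = bef s w ++ s :: r ∧ s ∉ bef s w := by
  induction w with
  | nil => simp at h
  | cons c a ih => simp only [bef_cons]; grind
theorem not_mem_bef (s : ℕ) (w : List ℕ) : s ∉ bef s w := by
  induction w with
  | nil => simp
  | cons c a ih => simp only [bef_cons]; grind

theorem split_first {s : ℕ} {w : List ℕ} (h : s ∈ w) : ∃ l r, w = l ++ s :: r ∧ s ∉ l := by
  obtain ⟨r, h1, h2⟩ := bef_split h
  exact ⟨_, r, h1, h2⟩

theorem split_last {s : ℕ} {w : List ℕ} (h : s ∈ w) : ∃ l r, w = l ++ s :: r ∧ s ∉ r := by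
  induction w with
  | nil => simp at h
  | cons c a ih =>
    by_cases hs : s ∈ a
    · obtain ⟨l, r, h1, h2⟩ := ih hs
      exact ⟨c :: l, r, by simp [h1], h2⟩
    · refine ⟨[], a, ?_, hs⟩
      simp at h
      grind

section Jev
variable {M : Type*} [Monoid M] (f : ℕ → M)

theorem ev_idem (hJ : JM M) {g : List ℕ} {x : ℕ} (h : x ∈ g) :
    ev f g * f x * f x = ev f g * f x := by
  obtain ⟨l, r, rfl, -⟩ := split_first h
  have := hJ.j1 (f x) (ev f r)
  simp only [ev_append, ev_cons]
  simp only [mul_assoc] at this ⊢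
  rw [this]

theorem ev_comm (hJ : JM M) {g : List ℕ} {x y : ℕ} (hx : x ∈ g) (hy : y ∈ g) :
    ev f g * f x * f y = ev f g * f y * f x := by
  have h1 := ev_idem f hJ (g := g ++ [x]) (x := y) (by simp [hy])
  have h2 := ev_idem f hJ (g := g) (x := x) hx
  have h3 := ev_idem f hJ (g := g ++ [y]) (x := x) (by simp [hx])
  have h4 := ev_idem f hJ (g := g) (x := y) hy
  have h5 := hJ.j2 (f x) (f y)
  simp only [ev_append, ev_cons, ev_nil, mul_one] at h1 h3
  calc ev f g * f x * f y = ev f g * (f x * f x * f y * f y) := by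
        rw [← h1, ← h2]; simp only [mul_assoc]
    _ = ev f g * (f y * f y * f x * f x) := by rw [h5]
    _ = ev f g * f y * f x := by
        rw [← h3, ← h4]; simp only [mul_assoc]

theorem ev_ins1 (hJ : JM M) {g r : List ℕ} {x : ℕ} (hg : 2 ≤ g.count x) (hr : x ∈ r) :
    ev f (g ++ r) = ev f (g ++ x :: r) := by
  have hx : x ∈ g := by apply List.count_pos_iff.mp; omega
  obtain ⟨g1, g', rfl, hn⟩ := split_first hx
  have hx2 : x ∈ g' := by
    apply List.count_pos_iff.mp
    simp [List.count_eq_zero_of_not_mem hn] at hg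
    simpa using hg
  obtain ⟨g2, g3, rfl, -⟩ := split_first hx2
  obtain ⟨r1, r2, rfl, -⟩ := split_first hr
  have := hJ.j4 (f x) (ev f g2) (ev f g3) (ev f r1)
  have := congrArg (fun a => ev f g1 * a * ev f r2) this
  simpa [mul_assoc] using this

theorem ev_ins2_step (hJ : JM M) {g r : List ℕ} {x d : ℕ} (hx : x ∈ g)
    (hd : 2 ≤ (g ++ x :: d :: r).count d) :
    ev f (g ++ x :: d :: r) = ev f (g ++ x :: d :: x :: r) := by
  by_cases hdx : d = x
  · subst hdx
    have := ev_idem f hJ (g := g ++ [d]) (x := d) (by simp)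
    simp only [ev_append, ev_cons, ev_nil, mul_one] at this
    simp only [ev_append, ev_cons, ← mul_assoc]
    rw [this]
  by_cases hdg : d ∈ g
  · have h1 := ev_comm f hJ (g := g ++ [x]) (x := x) (y := d) (by simp) (by simp [hdg])
    have h2 := ev_idem f hJ hx
    simp only [ev_append, ev_cons, ev_nil, mul_one] at h1
    simp only [ev_append, ev_cons, ← mul_assoc]
    rw [← h1, h2]
  · have hdr : d ∈ r := by
      apply List.count_pos_iff.mp
      have : g.count d = 0 := List.count_eq_zero_of_not_mem hdg
      simp [List.count_cons, this, Ne.symm hdx] at hd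
      simpa using hd
    obtain ⟨r1, r2, rfl, -⟩ := split_first hdr
    have := hJ.jn (f x) [(ev f r1, f d)] [f d] (by simp)
    simp only [List.map_cons, List.map_nil, List.prod_cons, List.prod_nil, mul_one] at this
    have := congrArg (fun a => ev f g * a * ev f r2) this
    have h2 := ev_idem f hJ hx
    simp only [← mul_assoc] at this
    rw [h2] at this
    simp only [ev_append, ev_cons, ← mul_assoc]
    exact this.symm

theorem ev_ins2 (hJ : JM M) (m : List ℕ) : ∀ {g r : List ℕ} {x : ℕ}, x ∈ g →
    (∀ d ∈ m, 2 ≤ (g ++ x :: (m ++ r)).count d) →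
    ev f (g ++ x :: (m ++ r)) = ev f (g ++ x :: (m ++ x :: r)) := by
  induction m with
  | nil =>
    intro g r x hx _
    have := ev_idem f hJ hx
    simp only [ev_append, ev_cons, ← mul_assoc, List.nil_append]
    rw [this]
  | cons d m ih =>
    intro g r x hx hd
    have h1 := ev_ins2_step f hJ (r := m ++ r) hx (hd d (by simp))
    have h2 := ih (g := g ++ [x, d]) (r := r) (x := x) (by simp) (by
      intro e he
      have := hd e (by simp [he])
      simp [List.count_append, List.count_cons] at this ⊢
      omega)
    have h3 := ev_ins1 f hJ (g := g ++ [x, d]) (r := m ++ x :: r) (x := x) (by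
      have := List.count_pos_iff.mpr hx
      simp [List.count_append, List.count_cons]; omega) (by simp)
    simp only [List.append_assoc, List.cons_append, List.nil_append] at h1 h2 h3 ⊢
    rw [h1, h2, h3]

/-- The insertion lemma. -/
theorem ev_ins (hJ : JM M) {g r : List ℕ} {x : ℕ} (hg : 2 ≤ g.count x)
    (hs : ∀ s ∈ g, (g ++ r).count s = 1 → Pr s x (g ++ r)) :
    ev f (g ++ r) = ev f (g ++ x :: r) := by
  by_cases hr : x ∈ r
  · exact ev_ins1 f hJ hg hr
  have hx : x ∈ g := by apply List.count_pos_iff.mp; omega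
  obtain ⟨g1, m, rfl, hm⟩ := split_last hx
  have hx1 : x ∈ g1 := by
    apply List.count_pos_iff.mp
    have : m.count x = 0 := List.count_eq_zero_of_not_mem hm
    simp [this] at hg
    simpa using hg
  have := ev_ins2 f hJ m (g := g1) (r := r) (x := x) hx1 (by
    intro d hd
    by_contra hlt
    have hpos : 0 < m.count d := List.count_pos_iff.mpr hd
    have h1 : (g1 ++ x :: m ++ r).count d = 1 := by
      simp [List.count_append, List.count_cons] at hlt ⊢
      omega
    have h2 := hs d (by simp [hd]) h1
    simp [List.count_append, List.count_cons] at h1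
    have hg1 : d ∉ g1 := by rw [← List.count_eq_zero]; omega
    have hdx : d ≠ x := by grind
    have hr1 : d ∉ r := by rw [← List.count_eq_zero]; omega
    simp only [pr_append, pr_cons] at h2
    have := @pr_mem d x g1
    have := @pr_mem d x m
    have := @pr_mem d x r
    grind)
  simpa using this

theorem ev_ins_list (hJ : JM M) (e : List ℕ) {g r : List ℕ}
    (h : ∀ d ∈ e, 2 ≤ g.count d ∧ ∀ s ∈ g, (g ++ r).count s = 1 → Pr s d (g ++ r)) :
    ev f (g ++ r) = ev f (g ++ (e ++ r)) := by
  induction e with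
  | nil => simp
  | cons d e ih =>
    rw [ih (fun a ha => h a (by simp [ha]))]
    obtain ⟨h1, h2⟩ := h d (by simp)
    refine ev_ins f hJ h1 ?_
    intro s hs hc
    have : 0 < g.count s := List.count_pos_iff.mpr hs
    have := h2 s hs (by simp [List.count_append] at hc ⊢; omega)
    simp only [pr_append, List.mem_append] at this ⊢
    tauto

theorem chop (hJ : JM M) (b : List ℕ) : ∀ m : List ℕ, (∀ d ∈ m, d ∈ b) →
    ∃ (p : List (M × M)) (r : M) (k : ℕ),
      (p.map Prod.snd).Perm (m.map f ++ List.replicate k 1) ∧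
      ∀ g : List ℕ, (∀ d ∈ m, d ∈ g) →
        ev f (g ++ b) = ev f g * (p.map fun a => a.1 * a.2).prod * r := by
  induction b with
  | nil =>
    intro m hm
    have : m = [] := List.eq_nil_iff_forall_not_mem.mpr (fun a ha => by simpa using hm a ha)
    subst this
    exact ⟨[], 1, 0, by simp, by simp⟩
  | cons c b ih =>
    intro m hm
    obtain ⟨p, r, k, hp, he⟩ := ih (m.filter (fun d => ¬ (d = c))) (by grind)
    refine ⟨List.replicate (m.count c) (1, f c) ++ (f c, 1) :: p, r, k + 1, ?_, ?_⟩
    · have h1 : (m.filter (fun d => d = c) ++ m.filter (fun d => ¬ (d = c))).Perm m := by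
        have := List.filter_append_perm (fun d => decide (d = c)) m
        simpa using this
      have h2 : m.filter (fun d => d = c) = List.replicate (m.count c) c := by
        exact List.filter_eq c
      rw [h2] at h1
      have h3 := (h1.map f).append_right (List.replicate (k+1) 1)
      refine List.Perm.trans ?_ h3
      simp only [List.map_append, List.map_replicate, List.map_cons, List.append_assoc]
      refine List.Perm.append_left _ ?_
      rw [List.replicate_succ]
      exact (hp.cons 1).trans List.perm_middle.symm
    · intro g hg
      have h1 := he (g ++ [c]) (by grind)
      have h2 : ∀ n, (0 < n → c ∈ g) → ev f g * (f c) ^ n * f c = ev f g * f c := by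
        intro n
        induction n with
        | zero => simp
        | succ n ihn =>
          intro hc
          rw [pow_succ', ← mul_assoc, mul_assoc _ (f c ^ n), ← pow_succ, pow_succ', ← mul_assoc,
            ev_idem f hJ (hc (by simp)), mul_assoc, ← pow_succ', pow_succ, ← mul_assoc]
          exact ihn (fun _ => hc (by simp))
      have h3 := h2 (m.count c) (fun h => hg c (List.count_pos_iff.mp h))
      simp only [List.append_assoc, List.cons_append, List.nil_append] at h1
      rw [h1]
      simp only [ev_append, ev_cons, ev_nil, mul_one, List.map_append, List.map_replicate,
        one_mul, List.prod_append, List.prod_replicate, List.map_cons, List.prod_cons, ← mul_assoc]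
      rw [h3]

theorem ev_scheme (hJ : JM M) {g m b : List ℕ} {x : ℕ} (hm : ∀ d ∈ m, d ∈ b) :
    ev f (g ++ x :: (m ++ x :: b)) = ev f (g ++ x :: x :: (m ++ b)) := by
  obtain ⟨p, r, k, hp, he⟩ := chop f hJ b m hm
  have h1 := he (g ++ x :: (m ++ [x])) (by grind)
  have h2 := he (g ++ x :: x :: m) (by grind)
  have h3 := hJ.jn (f x) p _ hp.symm
  simp only [List.prod_append, List.prod_replicate, one_pow, mul_one] at h3
  have h4 := congrArg (fun a => ev f g * a * r) h3
  simp only [List.append_assoc, List.cons_append, List.nil_append] at h1 h2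
  rw [h1, h2]
  simpa [ev, mul_assoc] using h4

/-- The second occurrence of `x` may be moved inside a block containing the first one. -/
theorem ev_slide (hJ : JM M) {g m b : List ℕ} {x : ℕ}
    (hm : ∀ d ∈ m, 2 ≤ (g ++ x :: (m ++ x :: b)).count d) :
    ev f (g ++ x :: (m ++ x :: b)) = ev f (g ++ x :: x :: (m ++ b)) := by
  let e := m.filter (fun d => d ∉ b)
  have he : ∀ d ∈ e, d ∈ m ∧ d ∉ b := by simp [e]
  have key : ∀ G : List ℕ, (∀ d, G.count d = (g ++ x :: (m ++ [x])).count d) →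
      (∀ s ∈ g, ∀ d ∈ m, Pr s d G) → ev f (G ++ b) = ev f (G ++ (e ++ b)) := by
    intro G hG hP
    apply ev_ins_list f hJ
    intro d hd
    obtain ⟨h1, h2⟩ := he d hd
    have h3 := hm d h1
    have h4 : b.count d = 0 := List.count_eq_zero_of_not_mem h2
    constructor
    · rw [hG]; simp [List.count_append, List.count_cons] at h3 ⊢; omega
    · intro s hs hc
      have hs' : s ∈ g ++ x :: (m ++ [x]) := by
        rw [← List.count_pos_iff, ← hG, List.count_pos_iff]; exact hs
      by_cases hsg : s ∈ g
      · simp [hP s hsg d h1]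
      · exfalso
        rw [List.count_append, hG] at hc
        have : s = x ∨ s ∈ m := by grind
        rcases this with rfl | h
        · simp [List.count_append, List.count_cons] at hc
          omega
        · have := hm s h
          simp [List.count_append, List.count_cons] at hc this
          omega
  have k1 := key (g ++ x :: (m ++ [x])) (fun _ => rfl) (by
    intro s hs d hd; simp [hs, hd])
  have k2 := key (g ++ x :: x :: m) (by
    intro d; simp [List.count_append, List.count_cons]) (by
    intro s hs d hd; simp [hs, hd])
  have k3 := ev_scheme f hJ (g := g) (m := m) (b := e ++ b) (x := x) (by
    intro d hd
    by_cases h : d ∈ b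
    · simp [h]
    · simp [e, h, hd])
  simp only [List.append_assoc, List.cons_append, List.nil_append] at k1 k2 k3 ⊢
  rw [k1, k2, k3]

theorem ev_slide' (hJ : JM M) {g m1 m2 b : List ℕ} {x : ℕ}
    (hm : ∀ d ∈ m1 ++ m2, 2 ≤ (g ++ x :: (m1 ++ m2 ++ x :: b)).count d) :
    ev f (g ++ x :: (m1 ++ m2 ++ x :: b)) = ev f (g ++ x :: (m1 ++ x :: (m2 ++ x :: b))) := by
  have h1 := ev_slide f hJ hm
  have h2 := ev_slide f hJ (g := g) (m := m1) (b := m2 ++ x :: b) (x := x) (by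
    intro d hd
    have := hm d (by simp [hd])
    simp [List.count_append, List.count_cons] at this ⊢; omega)
  have h3 := ev_ins2 f hJ (m1 ++ m2) (g := g ++ [x]) (r := b) (x := x) (by simp) (by
    intro d hd
    have := hm d hd
    simp [List.count_append, List.count_cons] at this ⊢; omega)
  simp only [List.append_assoc, List.cons_append, List.nil_append] at h1 h2 h3 ⊢
  rw [h1, h2, h3]

/-- The swapping lemma. -/
theorem ev_swap (hJ : JM M) {g R1 R2 : List ℕ} {y c : ℕ} (hc : 1 ≤ (g ++ R1).count c)
    (hs : ∀ s ∈ R1, (g ++ y :: c :: (R1 ++ y :: R2)).count s = 1 → Pr s c (R1 ++ y :: R2)) :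
    ev f (g ++ y :: c :: (R1 ++ y :: R2)) = ev f (g ++ c :: y :: (R1 ++ y :: R2)) := by
  by_cases hyc : y = c
  · subst hyc; rfl
  have h1 := ev_ins f hJ (g := g ++ y :: c :: (R1 ++ [y])) (r := R2) (x := c) (by
    simp [List.count_append, List.count_cons, hyc] at hc ⊢; omega) (by
    intro s hs1 hs2
    have hsy : s ≠ y := by
      rintro rfl
      simp [List.count_append, List.count_cons] at hs2; omega
    by_cases hsg : s ∈ g
    · simp [hsg]
    by_cases hsR : s ∈ R1
    · have := hs s hsR (by simpa using hs2)
      simp at this ⊢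
      tauto
    have : s = c := by grind
    subst this
    simp [List.count_append, List.count_cons] at hs2 hc; omega)
  have h2 := ev_ins f hJ (g := g ++ c :: y :: (R1 ++ [y])) (r := R2) (x := c) (by
    simp [List.count_append, List.count_cons, hyc] at hc ⊢; omega) (by
    intro s hs1 hs2
    have hsy : s ≠ y := by
      rintro rfl
      simp [List.count_append, List.count_cons] at hs2; omega
    by_cases hsg : s ∈ g
    · simp [hsg]
    by_cases hsR : s ∈ R1
    · have := hs s hsR (by simp [List.count_append, List.count_cons] at hs2 ⊢; omega)
      simp at this ⊢
      tauto
    have : s = c := by grind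
    subst this
    simp [List.count_append, List.count_cons] at hs2 hc; omega)
  have h3 := congrArg (fun a => ev f g * a * ev f R2) (hJ.j3 (f y) (f c) (ev f R1))
  simp only [List.append_assoc, List.cons_append, List.nil_append] at h1 h2
  rw [h1, h2]
  simpa [mul_assoc] using h3

theorem ev_move (m : List ℕ) : ∀ {p r : List ℕ} {c : ℕ},
    (∀ m1 y m2, m = m1 ++ y :: m2 →
      ev f (p ++ m1 ++ y :: c :: (m2 ++ r)) = ev f (p ++ m1 ++ c :: y :: (m2 ++ r))) →
    ev f (p ++ (m ++ c :: r)) = ev f (p ++ c :: (m ++ r)) := by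
  induction m with
  | nil => simp
  | cons d m ih =>
    intro p r c h
    have h1 := ih (p := p ++ [d]) (r := r) (c := c) (by
      intro m1 y m2 hm
      have := h (d :: m1) y m2 (by simp [hm])
      simpa using this)
    have h2 := h [] d m rfl
    simp only [List.append_assoc, List.cons_append, List.nil_append] at h1 h2 ⊢
    rw [h1, h2]

end Jev

/-! ### The combinatorial invariants -/

/-- The invariants of an identity `u ≈ v`. -/
structure WInv (u v : List ℕ) : Prop where
  cnt : ∀ x, min 2 (u.count x) = min 2 (v.count x)
  h1 : ∀ s x, v.count s = 1 → min 2 ((bef s u).count x) = min 2 ((bef s v).count x)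
  h2 : ∀ s x, v.count s = 1 → (Pr s x u ↔ Pr s x v)
  d : ∀ x y z s, x ≠ y → 2 ≤ v.count x → 2 ≤ v.count y → v.count z = 1 → v.count s = 1 →
    z ∈ bef x v → (bef s v).count x = 1 → ¬ Pr s y v → (bef z v).count y ≤ 1 →
    (Pr z y (bef x u) ↔ Pr z y (bef x v))

theorem cnt0 {x : ℕ} {l : List ℕ} : x ∉ l → l.count x = 0 := List.count_eq_zero_of_not_mem

theorem WInv.sim {u v : List ℕ} (h : WInv u v) (s : ℕ) : u.count s = 1 ↔ v.count s = 1 := by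
  have := h.cnt s; omega

theorem pr_of_count {y z : ℕ} {p : List ℕ} (hz : z ∈ p) (h1 : (bef z p).count y ≤ 1)
    (h2 : 2 ≤ p.count y) (hyz : y ≠ z) : Pr z y p := by
  obtain ⟨r, hr, -⟩ := bef_split hz
  rw [hr] at h2 ⊢
  have : 0 < r.count y := by
    simp [List.count_append, List.count_cons, Ne.symm hyz] at h2; omega
  simp [List.count_pos_iff.mp this]

theorem inv_delete {p m r b : List ℕ} {c : ℕ} (h : WInv (p ++ (m ++ c :: r)) (p ++ c :: b))
    (hc : (p ++ c :: b).count c = 1) (hcm : c ∉ m) (hm : ∀ d ∈ m, 2 ≤ p.count d)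
    (hP : ∀ s ∈ p, (p ++ c :: b).count s = 1 → ∀ d ∈ m, Pr s d (p ++ c :: r)) :
    WInv (p ++ c :: r) (p ++ c :: b) := by
  have hsm : ∀ s, (p ++ c :: b).count s = 1 → s ∉ m := by
    intro s hs hsm
    have := hm s hsm
    simp [List.count_append] at hs; omega
  have hcp : c ∉ p := by
    intro h'
    have := List.count_pos_iff.mpr h'
    simp [List.count_append] at hc; omega
  refine ⟨?_, ?_, ?_, ?_⟩
  · intro x
    have := h.cnt x
    by_cases hx : x ∈ m
    · have := hm x hx
      simp only [List.count_append] at *; omega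
    · have := cnt0 hx
      simp only [List.count_append] at *; omega
  · intro s x hs
    have h1 := h.h1 s x hs
    by_cases hsp : s ∈ p
    · simp only [bef_append_mem hsp]
    · rw [bef_append_not_mem hsp, bef_append_not_mem (hsm s hs)] at h1
      rw [bef_append_not_mem hsp]
      by_cases hx : x ∈ m
      · have := hm x hx
        rw [bef_append_not_mem hsp]
        simp only [List.count_append] at *; omega
      · have := cnt0 hx
        simp only [List.count_append] at *; omega
  · intro s x hs
    rw [← h.h2 s x hs]
    have hsm := hsm s hs
    by_cases hx : x ∈ m
    · by_cases hsp : s ∈ p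
      · have := hP s hsp hs x hx
        simp [hsp, hx] at this ⊢
        tauto
      · have h3 := @pr_mem s x m
        simp only [pr_append, pr_cons]
        tauto
    · have h3 := @pr_mem s x m
      simp only [pr_append, pr_cons, List.mem_append]
      tauto
  · intro x y z s hxy hx hy hz hs hzx hsx hsy hyz
    have hd := h.d x y z s hxy hx hy hz hs hzx hsx hsy hyz
    by_cases hxp : x ∈ p
    · simp only [bef_append_mem hxp]
    have hxc : x ≠ c := by rintro rfl; omega
    have hxm : x ∉ m := fun h' => hxp (by
      have := hm x h'; exact List.count_pos_iff.mp (by omega))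
    have hyz' : y ≠ z := by rintro rfl; omega
    have hzm := hsm z hz
    rw [bef_append_not_mem hxp, bef_append_not_mem hxm] at hd
    rw [bef_append_not_mem hxp]
    by_cases hy2 : 2 ≤ p.count y
    · rw [bef_append_not_mem hxp]
      by_cases hzp : z ∈ p
      · have := pr_of_count hzp (by rwa [bef_append_mem hzp] at hyz) hy2 hyz'
        simp [this]
      · rw [bef_append_not_mem hzp] at hyz
        simp only [List.count_append] at hyz; omega
    · have hym : y ∉ m := fun h' => hy2 (hm y h')
      rw [← hd]
      have h3 := @pr_mem z y m
      simp only [pr_append, List.mem_append]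
      tauto

theorem inv_insert {p a b : List ℕ} {c : ℕ} (h : WInv (p ++ a) (p ++ c :: b)) (hc : c ∈ p) :
    WInv (p ++ c :: a) (p ++ c :: b) := by
  have hcp := List.count_pos_iff.mpr hc
  have hne : ∀ s, (p ++ c :: b).count s = 1 → s ≠ c := by
    rintro s hs rfl
    simp [List.count_append] at hs; omega
  refine ⟨?_, ?_, ?_, ?_⟩
  · intro x
    have := h.cnt x
    simp only [List.count_append, List.count_cons] at this ⊢
    by_cases hx : c = x
    · subst hx; simp at this ⊢; omega
    · simp [hx] at this ⊢; omega
  · intro s x hs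
    have h1 := h.h1 s x hs
    have hsc := hne s hs
    by_cases hsp : s ∈ p
    · simp only [bef_append_mem hsp]
    · rw [bef_append_not_mem hsp] at h1 ⊢
      rw [bef_append_not_mem hsp] at h1 ⊢
      simp only [bef_cons, Ne.symm hsc, if_false, List.count_append, List.count_cons] at h1 ⊢
      by_cases hx : c = x
      · subst hx; simp at h1 ⊢; omega
      · simp [hx] at h1 ⊢; omega
  · intro s x hs
    have hsc := hne s hs
    have h2 := h.h2 s x hs
    simp only [pr_append, pr_cons, List.mem_cons] at h2 ⊢
    clear hs h hcp hne
    have h3 := @pr_mem s x p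
    by_cases hsp : s ∈ p <;> by_cases hx : x = c <;> simp [hsp, hx, Ne.symm hsc] at h2 h3 ⊢
    · exact h2
    · subst hx
      simpa [h3] using h2
    · exact h2
  · intro x y z s hxy hx hy hz hs hzx hsx hsy hyz
    have hd := h.d x y z s hxy hx hy hz hs hzx hsx hsy hyz
    by_cases hxp : x ∈ p
    · simp only [bef_append_mem hxp]
    have hzc := hne z hz
    have hcx : c ≠ x := by rintro rfl; exact hxp hc
    rw [bef_append_not_mem hxp] at hd ⊢
    rw [bef_append_not_mem hxp] at hd ⊢
    simp only [bef_cons, hcx, if_false] at hd ⊢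
    by_cases hyc : y = c
    · subst hyc
      by_cases hzp : z ∈ p
      · simp [hzp]
      · rw [bef_append_not_mem hzp] at hyz
        simp [bef_cons, Ne.symm hzc] at hyz; omega
    · simp only [pr_append, pr_cons, List.mem_cons] at hd ⊢
      simp only [hyc, Ne.symm hzc] at hd ⊢
      simp only [false_or, false_and] at hd ⊢
      exact hd

theorem inv_move {p m r b : List ℕ} {c : ℕ} (h : WInv (p ++ (m ++ c :: r)) (p ++ c :: b))
    (hc : 2 ≤ (p ++ c :: b).count c) (hcp : c ∉ p) (hcm : c ∉ m)
    (hm : ∀ d ∈ m, (p ++ c :: b).count d ≠ 1) :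
    WInv (p ++ c :: (m ++ r)) (p ++ c :: b) := by
  have hne : ∀ s, (p ++ c :: b).count s = 1 → s ≠ c := by
    rintro s hs rfl; omega
  refine ⟨?_, ?_, ?_, ?_⟩
  · intro x
    have := h.cnt x
    simp only [List.count_append, List.count_cons] at *
    omega
  · intro s x hs
    have h1 := h.h1 s x hs
    have hsc := hne s hs
    have hsm : s ∉ m := fun h' => hm s h' hs
    by_cases hsp : s ∈ p
    · simp only [bef_append_mem hsp]
    · rw [bef_append_not_mem hsp, bef_append_not_mem hsm] at h1
      rw [bef_append_not_mem hsp]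
      simp only [bef_cons, Ne.symm hsc, if_false, bef_append_not_mem hsm, List.count_append,
        List.count_cons] at *
      omega
  · intro s x hs
    have hsc := hne s hs
    have hsm : s ∉ m := fun h' => hm s h' hs
    rw [← h.h2 s x hs]
    have h3 : ¬ Pr s x m := fun h => hsm (pr_mem h).1
    simp only [pr_append, pr_cons, List.mem_cons, List.mem_append, hsm, h3, Ne.symm hsc,
      false_or, false_and, or_false]
    clear h hs hm
    tauto
  · intro x y z s hxy hx hy hz hs hzx hsx hsy hyz
    have hd := h.d x y z s hxy hx hy hz hs hzx hsx hsy hyz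
    by_cases hxp : x ∈ p
    · simp only [bef_append_mem hxp]
    have hzc := hne z hz
    have hzm : z ∉ m := fun h' => hm z h' hz
    rw [bef_append_not_mem hxp] at hd ⊢
    rw [bef_append_not_mem hxp] at hd ⊢
    by_cases hcx : c = x
    · subst hcx
      simp
    have h3 : ¬ Pr z y m := fun h => hzm (pr_mem h).1
    clear hs hz hx hy h hm hc hyz hsx hsy hzx
    by_cases hxm : x ∈ m
    · rw [bef_append_mem hxm] at hd
      simp only [bef_cons, hcx, if_false, bef_append_mem hxm] at hd ⊢
      have h4 : z ∉ bef x m := by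
        obtain ⟨t, ht, -⟩ := bef_split hxm
        intro h'
        apply hzm
        rw [ht]; simp [h']
      have h5 : ¬ Pr z y (bef x m) := fun h => h4 (pr_mem h).1
      by_cases hyc : y = c
      · subst hyc
        have h6 : y ∉ bef x m := by
          obtain ⟨t, ht, -⟩ := bef_split hxm
          intro h'
          apply hcm
          rw [ht]; simp [h']
        simp only [pr_append, pr_cons, List.mem_cons, h4, h5, h6, Ne.symm hzc, 
          false_or, false_and, or_false, true_or, and_true] at hd ⊢
        by_cases hzp : z ∈ p
        · simp [hzp]
        · simpa [hzp] using hd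
      · simp only [pr_append, pr_cons, List.mem_cons, hyc, h5, h4, Ne.symm hzc, 
          false_or, false_and, or_false] at hd ⊢
        exact hd
    · rw [bef_append_not_mem hxm] at hd
      simp only [bef_cons, hcx, if_false, bef_append_not_mem hxm] at hd ⊢
      simp only [pr_append, pr_cons, List.mem_cons, List.mem_append, h3, hzm, Ne.symm hzc,
          false_or, false_and, or_false] at hd ⊢
      rw [← hd]
      rw [or_left_comm (a := y = c)]

/-! ### The reduction steps -/

section Steps
variable {M : Type*} [Monoid M] (f : ℕ → M)

theorem mem_cnt {x : ℕ} {l : List ℕ} (h : x ∈ l) : 1 ≤ l.count x := List.count_pos_iff.mpr h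

theorem step_simple (hJ : JM M) {p a b : List ℕ} {c : ℕ} (h : WInv (p ++ a) (p ++ c :: b))
    (hc : (p ++ c :: b).count c = 1) :
    ∃ r, ev f (p ++ a) = ev f (p ++ c :: r) ∧ WInv (p ++ c :: r) (p ++ c :: b) := by
  have hcp : c ∉ p := by
    intro h'
    have := mem_cnt h'
    simp [List.count_append] at hc; omega
  have hcu := (h.sim c).2 hc
  have hca : c ∈ a := by
    apply List.count_pos_iff.mp
    have := cnt0 hcp
    simp [List.count_append] at hcu; omega
  obtain ⟨m, r, rfl, hcm⟩ := split_first hca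
  have hcr : c ∉ r := by
    intro h'
    have := mem_cnt h'
    simp [List.count_append] at hcu; omega
  have hm : ∀ d ∈ m, 2 ≤ p.count d := by
    intro d hd
    have h1 := h.h1 c d hc
    rw [bef_append_not_mem hcp, bef_append_not_mem hcp, bef_append_not_mem hcm] at h1
    have := mem_cnt hd
    simp [List.count_append] at h1; omega
  have hP : ∀ s ∈ p, (p ++ c :: b).count s = 1 → ∀ d ∈ m, Pr s d (p ++ c :: r) := by
    intro s hsp hs d hd
    have hdc : d ≠ c := by rintro rfl; exact hcm hd
    by_cases hdr : d ∈ r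
    · simp [hsp, hdr]
    have e1 : ¬ Pr c d p := fun h => hcp (pr_mem h).1
    have e2 : ¬ Pr c d m := fun h => hcm (pr_mem h).1
    have e3 : ¬ Pr c d r := fun h => hcr (pr_mem h).1
    have h3 := h.h2 c d hc
    simp [hcp, hcm, e1, e2, e3, hdr] at h3
    have h4 := h.h2 s d hs
    have e4 : ¬ Pr s d b := fun h => h3.1 (pr_mem h).2
    simp [hsp, hd, hdc, h3.1, e4] at h4
    simp [h4]
  refine ⟨r, ?_, inv_delete h hc hcm hm hP⟩
  refine (ev_ins_list f hJ m (g := p) (r := c :: r) ?_).symm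
  intro d hd
  refine ⟨hm d hd, fun s hsp hs => hP s hsp ?_ d hd⟩
  have e := mem_cnt hsp
  have hsm : s ∉ m := by
    intro h'
    have := hm s h'
    simp only [List.count_append] at hs; omega
  have := cnt0 hsm
  rw [← h.sim s]
  simp only [List.count_append] at hs ⊢; omega

theorem no_simple {p m r b : List ℕ} {c : ℕ} (h : WInv (p ++ (m ++ c :: r)) (p ++ c :: b))
    (hcm : c ∉ m) (hp : p.count c ≤ 1) : ∀ d ∈ m, (p ++ c :: b).count d ≠ 1 := by
  intro d hd hs
  have hu := (h.sim d).2 hs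
  have hdp : d ∉ p := by
    intro h'
    have e1 := mem_cnt h'
    have e2 := mem_cnt hd
    simp only [List.count_append] at hu; omega
  have hdc : c ≠ d := by rintro rfl; exact hcm hd
  have h1 := h.h1 d c hs
  rw [bef_append_not_mem hdp, bef_append_not_mem hdp, bef_append_mem hd, bef_cons, if_neg hdc] at h1
  have : c ∉ bef d m := by
    obtain ⟨t, ht, -⟩ := bef_split hd
    intro h'
    apply hcm
    rw [ht]; simp [h']
  have := cnt0 this
  simp [List.count_append] at h1; omega

theorem WInv.nc {u v : List ℕ} (h : WInv u v) {x y z : ℕ} (hxy : x ≠ y) (hx : 2 ≤ v.count x)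
    (hy : 2 ≤ v.count y) (hz : v.count z = 1) (hzx : z ∈ bef x v) (hyz : (bef z v).count y ≤ 1)
    (hd : ¬ (Pr z y (bef x u) ↔ Pr z y (bef x v))) :
    ∀ s, v.count s = 1 → (bef s v).count x = 1 → Pr s y v := by
  intro s hs hsx
  by_contra hsy
  exact hd (h.d x y z s hxy hx hy hz hs hzx hsx hsy hyz)

theorem move_swap (hJ : JM M) {p m1 m2 r v R1 R2 : List ℕ} {y c α β : ℕ}
    (h : WInv (p ++ (m1 ++ y :: (m2 ++ c :: r))) v)
    (hns : ∀ d ∈ m1 ++ y :: m2, v.count d ≠ 1) (hcns : v.count c ≠ 1)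
    (hαβ : (α = y ∧ β = c) ∨ (α = c ∧ β = y)) (hyc : y ≠ c) (hα : α ∉ p ++ m1)
    (hR : m2 ++ r = R1 ++ α :: R2) (hαR : α ∉ R1)
    (nc : ∀ s, v.count s = 1 → (bef s v).count α = 1 → Pr s β v)
    (hβ : 1 ≤ (p ++ m1 ++ R1).count β) :
    ev f (p ++ m1 ++ α :: β :: (m2 ++ r)) = ev f (p ++ m1 ++ β :: α :: (m2 ++ r)) := by
  rw [hR]
  apply ev_swap f hJ hβ
  intro s hsR hs
  rw [← hR] at hs
  have hsu : (p ++ (m1 ++ y :: (m2 ++ c :: r))).count s = 1 := by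
    rcases hαβ with ⟨rfl, rfl⟩ | ⟨rfl, rfl⟩ <;>
      (simp only [List.count_append, List.count_cons] at hs ⊢; omega)
  have hsv := (h.sim s).1 hsu
  have hsm1 : s ∉ m1 := fun h' => hns s (by simp [h']) hsv
  have hsm2 : s ∉ m2 := fun h' => hns s (by simp [h']) hsv
  have hsy : y ≠ s := by rintro rfl; exact hns y (by simp) hsv
  have hsc : c ≠ s := by rintro rfl; exact hcns hsv
  have hsr : s ∈ r := by
    have : s ∈ m2 ++ r := by rw [hR]; simp [hsR]
    simpa [hsm2] using this
  have hsp : s ∉ p := by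
    intro h'
    have e1 := mem_cnt h'
    have e2 := mem_cnt hsr
    simp only [List.count_append, List.count_cons] at hsu; omega
  have hb : bef s (p ++ (m1 ++ y :: (m2 ++ c :: r))) = p ++ (m1 ++ y :: (m2 ++ c :: bef s r)) := by
    rw [bef_append_not_mem hsp, bef_append_not_mem hsm1, bef_cons, if_neg hsy,
      bef_append_not_mem hsm2, bef_cons, if_neg hsc]
  have hb2 : m2 ++ bef s r = bef s R1 := by
    rw [← bef_append_not_mem hsm2, hR, bef_append_mem hsR]
  have hb3 : α ∉ m2 ++ bef s r := by
    rw [hb2]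
    obtain ⟨t, ht, -⟩ := bef_split hsR
    intro h'
    apply hαR
    rw [ht]; simp [h']
  have hcnt : (bef s (p ++ (m1 ++ y :: (m2 ++ c :: r)))).count α = 1 := by
    rw [hb]
    have e1 := cnt0 hα
    have e2 := cnt0 hb3
    rcases hαβ with ⟨rfl, rfl⟩ | ⟨rfl, rfl⟩
    · simp [List.count_append, Ne.symm hyc] at e1 e2 ⊢; omega
    · simp [List.count_append, hyc] at e1 e2 ⊢; omega
  have h1 := h.h1 s α hsv
  have h2 := (h.h2 s β hsv).2 (nc s hsv (by omega))
  rw [← hR]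
  have e1 : ¬ Pr s β p := fun h => hsp (pr_mem h).1
  have e2 : ¬ Pr s β m1 := fun h => hsm1 (pr_mem h).1
  have e3 : ¬ Pr s β m2 := fun h => hsm2 (pr_mem h).1
  simp [e1, e2, e3, hsp, hsm1, hsm2, hsy, hsc] at h2 ⊢
  exact h2

theorem step_mem (hJ : JM M) {p a b : List ℕ} {c : ℕ} (h : WInv (p ++ a) (p ++ c :: b))
    (hc : c ∈ p) : ev f (p ++ a) = ev f (p ++ c :: a) := by
  have hcs : ∀ s ∈ p, (p ++ a).count s = 1 → Pr s c (p ++ a) := by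
    intro s hsp hs
    have hsv := (h.sim s).1 hs
    rw [h.h2 s c hsv]
    simp [hsp]
  by_cases hc2 : 2 ≤ p.count c
  · exact ev_ins f hJ hc2 hcs
  have hc1 : p.count c = 1 := by have := mem_cnt hc; omega
  have hcu : 2 ≤ (p ++ a).count c := by
    have := h.cnt c
    simp [List.count_append] at this ⊢; omega
  have hca : c ∈ a := by
    apply List.count_pos_iff.mp
    simp [List.count_append] at hcu; omega
  obtain ⟨m, r, rfl, hcm⟩ := split_first hca
  have hns := no_simple h hcm hc1.le
  have hcns : (p ++ c :: b).count c ≠ 1 := by simp [List.count_append]; omega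
  obtain ⟨p1, p2, hp, hcp1⟩ := split_first hc
  have hcp2 : c ∉ p2 := by
    intro h'
    have := mem_cnt h'
    rw [hp] at hc1
    simp [List.count_append] at hc1; omega
  by_cases hz : ∃ z ∈ p2, (p ++ c :: b).count z = 1
  · obtain ⟨z, hzp2, hz⟩ := hz
    have hzp : z ∈ p := by rw [hp]; simp [hzp2]
    have hzp1 : z ∉ p1 := by
      intro h'
      have e1 := mem_cnt h'
      have e2 := mem_cnt hzp2
      rw [hp] at hz
      simp only [List.count_append, List.count_cons] at hz; omega
    have hzc : z ≠ c := by rintro rfl; exact hcns hz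
    have k1 : ev f (p ++ (m ++ c :: r)) = ev f (p ++ c :: (m ++ r)) := by
      apply ev_move
      rintro m1 y m2 rfl
      have hyc : y ≠ c := by rintro rfl; simp at hcm
      by_cases hy : y ∈ p ++ m1
      · have := ev_comm f hJ (g := p ++ m1) hy (y := c) (by simp [hc])
        have := congrArg (fun a => a * ev f (m2 ++ r)) this
        simpa [mul_assoc] using this
      have hyv := hns y (by simp)
      have hyu : 2 ≤ (p ++ ((m1 ++ y :: m2) ++ c :: r)).count y := by
        have h1 := h.sim y
        have : 1 ≤ (p ++ ((m1 ++ y :: m2) ++ c :: r)).count y := mem_cnt (by simp)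
        by_contra hlt
        exact hyv (h1.1 (by omega))
      have hyR : y ∈ m2 ++ r := by
        apply List.count_pos_iff.mp
        have := cnt0 hy
        simp only [List.count_append, List.count_cons, beq_self_eq_true, if_true, beq_iff_eq,
          Ne.symm hyc, if_false] at this hyu ⊢
        omega
      obtain ⟨R1, R2, hR, hyR1⟩ := split_first hyR
      have hyp : y ∉ p := fun h' => hy (by simp [h'])
      have hym : y ∉ m1 := fun h' => hy (by simp [h'])
      have hcm1 : c ∉ m1 := fun h' => hcm (by simp [h'])
      refine move_swap f hJ (v := p ++ c :: b) (by simpa using h) hns hcns (Or.inl ⟨rfl, rfl⟩) hyc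
        hy hR hyR1 ?_ ?_
      · refine h.nc hyc ?_ ?_ hz ?_ ?_ ?_
        · have := h.cnt y; omega
        · have := h.cnt c; omega
        · rw [bef_append_not_mem hyp]; simp [hzp]
        · rw [bef_append_mem hzp]
          obtain ⟨t, ht, -⟩ := bef_split hzp
          have : p.count c = (bef z p ++ z :: t).count c := by rw [← ht]
          simp only [List.count_append] at this; omega
        · intro hiff
          have e2 : Pr z c (bef y (p ++ c :: b)) := by
            rw [bef_append_not_mem hyp, bef_cons, if_neg (Ne.symm hyc)]
            simp [hzp]
          have e1 := hiff.2 e2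
          rw [List.append_assoc, bef_append_not_mem hyp, bef_append_not_mem hym, List.cons_append,
            bef_cons_self, hp] at e1
          have e3 : ¬ Pr z c p1 := fun h => hcp1 (pr_mem h).2
          have e4 : ¬ Pr z c p2 := fun h => hcp2 (pr_mem h).2
          have e5 : ¬ Pr z c m1 := fun h => hcm1 (pr_mem h).2
          simp [e3, e4, e5, hzp1, Ne.symm hzc, hcm1] at e1
      · have := mem_cnt hc
        simp only [List.count_append]; omega
    have k2 := ev_ins f hJ (g := p ++ c :: m) (r := r) (x := c) (by
      simp [List.count_append]; omega) (by
      intro s hs1 hs2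
      have hsu : (p ++ (m ++ c :: r)).count s = 1 := by
        simp only [List.count_append, List.count_cons] at hs2 ⊢; omega
      have hsv := (h.sim s).1 hsu
      have hsm : s ∉ m := fun h' => hns s h' hsv
      have hsc : s ≠ c := by rintro rfl; exact hcns hsv
      have hsp : s ∈ p := by simpa [hsm, hsc] using hs1
      simp [hsp])
    rw [k1]
    simpa using k2
  · have hz' : ∀ z ∈ p2, (p ++ c :: b).count z ≠ 1 := fun z h1 h2 => hz ⟨z, h1, h2⟩
    have := ev_slide' f hJ (g := p1) (m1 := p2) (m2 := m) (b := r) (x := c) (by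
      intro d hd
      have e0 : p1 ++ c :: (p2 ++ m ++ c :: r) = p ++ (m ++ c :: r) := by rw [hp]; simp
      have e1 : (p ++ c :: b).count d ≠ 1 := by
        rcases List.mem_append.1 hd with h' | h'
        · exact hz' d h'
        · exact hns d h'
      have e2 : 1 ≤ (p1 ++ c :: (p2 ++ m ++ c :: r)).count d := mem_cnt (by
        simp only [List.mem_append] at hd; simp; tauto)
      have e3 := h.sim d
      rw [e0] at e2 ⊢
      by_contra hlt
      exact e1 (e3.1 (by omega)))
    rw [hp]
    simpa using this

theorem step_new (hJ : JM M) {p a b : List ℕ} {c : ℕ} (h : WInv (p ++ a) (p ++ c :: b))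
    (hcp : c ∉ p) (hc2 : 2 ≤ (p ++ c :: b).count c) (hz : ∃ z ∈ p, (p ++ c :: b).count z = 1) :
    ∃ r, ev f (p ++ a) = ev f (p ++ c :: r) ∧ WInv (p ++ c :: r) (p ++ c :: b) := by
  have hcu : 2 ≤ (p ++ a).count c := by have := h.cnt c; omega
  have hcp0 := cnt0 hcp
  have hca : c ∈ a := by
    apply List.count_pos_iff.mp
    simp [List.count_append] at hcu; omega
  obtain ⟨m, r, rfl, hcm⟩ := split_first hca
  have hns := no_simple h hcm (by omega)
  have hcns : (p ++ c :: b).count c ≠ 1 := by omega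
  refine ⟨m ++ r, ?_, inv_move h hc2 hcp hcm hns⟩
  apply ev_move
  rintro m1 y m2 rfl
  have hyc : y ≠ c := by rintro rfl; simp at hcm
  have hyv := hns y (by simp)
  have hyu : 2 ≤ (p ++ ((m1 ++ y :: m2) ++ c :: r)).count y := by
    have h1 := h.sim y
    have : 1 ≤ (p ++ ((m1 ++ y :: m2) ++ c :: r)).count y := mem_cnt (by simp)
    by_contra hlt
    exact hyv (h1.1 (by omega))
  have hyv2 : 2 ≤ (p ++ c :: b).count y := by have := h.cnt y; omega
  have hcm1 : c ∉ m1 := fun h' => hcm (by simp [h'])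
  have hcm2 : c ∉ m2 := fun h' => hcm (by simp [h'])
  have hcg : c ∉ p ++ m1 := by simp [hcp, hcm1]
  have hcr : c ∈ r := by
    apply List.count_pos_iff.mp
    have := cnt0 hcm
    simp only [List.count_append, List.count_cons, beq_self_eq_true, if_true, beq_iff_eq,
      hyc, if_false] at hcu this
    omega
  have h' : WInv (p ++ (m1 ++ y :: (m2 ++ c :: r))) (p ++ c :: b) := by simpa using h
  have hbcu : bef c (p ++ ((m1 ++ y :: m2) ++ c :: r)) = p ++ (m1 ++ y :: m2) := by
    rw [bef_append_not_mem hcp, bef_append_not_mem hcm]; simp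
  have hbcv : bef c (p ++ c :: b) = p := by
    rw [bef_append_not_mem hcp]; simp
  -- condition (c, y)
  have hnc2 : ∀ z ∈ p, (p ++ c :: b).count z = 1 → p.count y ≤ 1 → ¬ Pr z y p →
      ∀ s, (p ++ c :: b).count s = 1 → (bef s (p ++ c :: b)).count c = 1 → Pr s y (p ++ c :: b) := by
    intro z hzp hz hpy hpr
    refine h.nc (Ne.symm hyc) hc2 hyv2 hz (by rw [hbcv]; exact hzp) ?_ ?_
    · rw [bef_append_mem hzp]
      obtain ⟨t, ht, -⟩ := bef_split hzp
      have : p.count y = (bef z p ++ z :: t).count y := by rw [← ht]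
      simp only [List.count_append] at this; omega
    · rw [hbcu, hbcv]
      intro hiff
      exact hpr (hiff.1 (by simp [hzp]))
  by_cases hg2 : 2 ≤ (p ++ m1).count y
  · have k1 := ev_ins f hJ (g := p ++ m1 ++ [y, c]) (r := m2 ++ r) (x := y) (by
      simp [List.count_append] at hg2 ⊢; omega) (by
      intro s hs1 hs2
      have hsu : (p ++ (m1 ++ y :: (m2 ++ c :: r))).count s = 1 := by
        simp only [List.count_append, List.count_cons, List.count_nil] at hs2 ⊢; omega
      have hsv := (h'.sim s).1 hsu
      have hsc : s ≠ c := by rintro rfl; exact hcns hsv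
      have hsy : s ≠ y := by rintro rfl; exact hyv hsv
      have : s ∈ p ∨ s ∈ m1 := by simpa [hsc, hsy] using hs1
      rcases this with h | h <;> simp [h])
    have k2 := ev_ins f hJ (g := p ++ m1) (r := c :: y :: (m2 ++ r)) (x := y) hg2 (by
      intro s hs1 hs2
      have : s ∈ p ∨ s ∈ m1 := by simpa using hs1
      rcases this with h | h <;> simp [h])
    rw [k2]
    simpa using k1
  have hpy : p.count y ≤ 1 := by simp only [List.count_append] at hg2; omega
  by_cases hg1 : y ∈ p ++ m1
  · obtain ⟨g1, g2, hg, hyg1⟩ := split_first hg1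
    have hyg2 : y ∉ g2 := by
      intro h'
      have := mem_cnt h'
      rw [hg] at hg2
      simp [List.count_append] at hg2; omega
    by_cases hz2 : ∃ z ∈ g2, (p ++ c :: b).count z = 1
    · obtain ⟨z, hzg2, hz⟩ := hz2
      have hzu := (h'.sim z).2 hz
      have hzm1 : z ∉ m1 := fun h' => hns z (by simp [h']) hz
      have hzp : z ∈ p := by
        have : z ∈ p ++ m1 := by rw [hg]; simp [hzg2]
        simpa [hzm1] using this
      have hzg1 : z ∉ g1 := by
        intro h''
        have e1 := mem_cnt h''
        have e2 := mem_cnt hzg2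
        have e3 : (p ++ m1).count z = (g1 ++ y :: g2).count z := by rw [hg]
        simp only [List.count_append, List.count_cons] at hzu e3; omega
      have hzy : z ≠ y := by rintro rfl; exact hyg2 hzg2
      have hR : c ∈ m2 ++ r := by simp [hcr]
      obtain ⟨R1, R2, hR, hcR1⟩ := split_first hR
      refine (move_swap f hJ h' hns hcns (Or.inr ⟨rfl, rfl⟩) hyc hcg hR hcR1
        (hnc2 z hzp hz hpy ?_) ?_).symm
      · intro hpr
        have e1 : Pr z y (p ++ m1) := by simp [hpr]
        rw [hg] at e1
        have e3 : ¬ Pr z y g1 := fun h => hyg1 (pr_mem h).2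
        have e4 : ¬ Pr z y g2 := fun h => hyg2 (pr_mem h).2
        simp [e3, e4, hzg1, Ne.symm hzy] at e1
      · have := mem_cnt hg1
        simp only [List.count_append] at this ⊢; omega
    · have hz' : ∀ z ∈ g2, (p ++ c :: b).count z ≠ 1 := fun z h1 h2 => hz2 ⟨z, h1, h2⟩
      have hmul : ∀ z ∈ c :: g2, 2 ≤ (p ++ (m1 ++ y :: (m2 ++ c :: r))).count z := by
        intro z hzg
        have e1 : (p ++ c :: b).count z ≠ 1 := by
          rcases List.mem_cons.1 hzg with rfl | h'
          · exact hcns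
          · exact hz' z h'
        have e2 : 1 ≤ (p ++ (m1 ++ y :: (m2 ++ c :: r))).count z := by
          rcases List.mem_cons.1 hzg with rfl | h'
          · exact mem_cnt (by simp)
          · have : 1 ≤ (p ++ m1).count z := by rw [hg]; exact mem_cnt (by simp [h'])
            simp only [List.count_append] at this ⊢; omega
        by_contra hlt
        exact e1 ((h'.sim z).1 (by omega))
      have hcntg : ∀ z, p.count z + m1.count z = (g1 ++ y :: g2).count z := by
        intro z; rw [← hg]; simp only [List.count_append]
      have k1 := ev_slide f hJ (g := g1) (m := g2) (b := c :: (m2 ++ r)) (x := y) (by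
        intro d hd
        have e1 := hmul d (by simp [hd])
        have e2 := hcntg d
        simp only [List.count_append, List.count_cons] at e1 e2 ⊢; omega)
      have k2 := ev_slide f hJ (g := g1) (m := g2 ++ [c]) (b := m2 ++ r) (x := y) (by
        intro d hd
        have e1 := hmul d (by simp at hd ⊢; tauto)
        have e2 := hcntg d
        simp only [List.count_append, List.count_cons, List.count_nil] at e1 e2 ⊢; omega)
      rw [hg]
      simp only [List.append_assoc, List.cons_append, List.nil_append] at k1 k2 ⊢
      rw [k1, k2]
  · have hyp : y ∉ p := fun h' => hg1 (by simp [h'])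
    have hym : y ∉ m1 := fun h' => hg1 (by simp [h'])
    obtain ⟨z, hzp, hz⟩ := hz
    have nc2 := hnc2 z hzp hz hpy (fun h => hyp (pr_mem h).2)
    have nc1 : ∀ s, (p ++ c :: b).count s = 1 → (bef s (p ++ c :: b)).count y = 1 →
        Pr s c (p ++ c :: b) := by
      refine h'.nc hyc hyv2 hc2 hz ?_ ?_ ?_
      · rw [bef_append_not_mem hyp]; simp [hzp]
      · rw [bef_append_mem hzp]
        obtain ⟨t, ht, -⟩ := bef_split hzp
        have : p.count c = (bef z p ++ z :: t).count c := by rw [← ht]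
        simp only [List.count_append] at this; omega
      · intro hiff
        have e2 : Pr z c (bef y (p ++ c :: b)) := by
          rw [bef_append_not_mem hyp, bef_cons, if_neg (Ne.symm hyc)]
          simp [hzp]
        have e1 := (pr_mem (hiff.2 e2)).2
        rw [bef_append_not_mem hyp, bef_append_not_mem hym, bef_cons_self] at e1
        simp [hcp, hcm1] at e1
    have hyR : y ∈ m2 ++ r := by
      apply List.count_pos_iff.mp
      have := cnt0 hg1
      simp only [List.count_append, List.count_cons, beq_self_eq_true, if_true, beq_iff_eq,
        Ne.symm hyc, if_false] at this hyu ⊢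
      omega
    obtain ⟨R1, R2, hR, hyR1⟩ := split_first hyR
    by_cases hcR1 : c ∈ R1
    · refine move_swap f hJ h' hns hcns (Or.inl ⟨rfl, rfl⟩) hyc hg1 hR hyR1 nc1 ?_
      have := mem_cnt hcR1
      simp only [List.count_append]; omega
    · have hcR : c ∈ m2 ++ r := by simp [hcr]
      obtain ⟨S, hS, hcS⟩ := bef_split hcR
      refine (move_swap f hJ h' hns hcns (Or.inr ⟨rfl, rfl⟩) hyc hcg hS hcS nc2 ?_).symm
      apply mem_cnt
      rw [hR, bef_append_not_mem hcR1, bef_cons, if_neg hyc]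
      simp

theorem main_reduction (hJ : JM M) : ∀ b p a : List ℕ, WInv (p ++ a) (p ++ b) →
    (∃ z ∈ p, (p ++ b).count z = 1) → (∃ v' t, p ++ b = v' ++ [t] ∧ (p ++ b).count t = 1) →
    ev f (p ++ a) = ev f (p ++ b) := by
  intro b
  induction b with
  | nil =>
    intro p a h hz ht
    obtain ⟨v', t, hv, ht⟩ := ht
    rcases a with _ | ⟨d, a⟩
    · rfl
    exfalso
    have e : Pr t d (p ++ d :: a) := by
      have : t ∈ p := by
        have : t ∈ p ++ [] := by rw [hv]; simp
        simpa using this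
      simp [this]
    have e2 := (h.h2 t d ht).1 e
    rw [hv] at e2 ht
    have : t ∉ v' := by
      intro h'
      have := mem_cnt h'
      simp [List.count_append] at ht; omega
    have e3 : ¬ Pr t d v' := fun h => this (pr_mem h).1
    simp [e3, this] at e2
  | cons c b ih =>
    intro p a h hz ht
    obtain ⟨r, h1, h2⟩ : ∃ r, ev f (p ++ a) = ev f (p ++ c :: r) ∧
        WInv (p ++ c :: r) (p ++ c :: b) := by
      by_cases hc : (p ++ c :: b).count c = 1
      · exact step_simple f hJ h hc
      by_cases hcp : c ∈ p
      · exact ⟨a, step_mem f hJ h hcp, inv_insert h hcp⟩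
      · refine step_new f hJ h hcp ?_ hz
        have : 1 ≤ (p ++ c :: b).count c := mem_cnt (by simp)
        omega
    rw [h1]
    have := ih (p ++ [c]) r (by simpa using h2) (by
      obtain ⟨z, hz, hz'⟩ := hz
      exact ⟨z, by simp [hz], by simpa using hz'⟩) (by simpa using ht)
    simpa using this

end Steps

/-! ### The test monoids -/

/-- `M` satisfies `u ≈ v`, in terms of lists. -/
def SatL (M : Type*) [Monoid M] (u v : List ℕ) : Prop := ∀ f : ℕ → M, ev f u = ev f v

theorem hom_wd {M : Type*} [Monoid M] (φ : Word →* M) (l : List ℕ) :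
    φ (wd l) = ev (fun n => φ (of n)) l := by
  induction l with
  | nil => exact map_one φ
  | cons a l ih =>
    have : wd (a :: l) = of a * wd l := rfl
    rw [this, map_mul, ih, ev_cons]

theorem lift_wd {M : Type*} [Monoid M] (f : ℕ → M) (l : List ℕ) :
    FreeMonoid.lift f (wd l) = ev f l := by
  rw [hom_wd]; simp

theorem msat_iff {M : Type*} [Monoid M] (u v : List ℕ) :
    MSat M (wd u, wd v) ↔ SatL M u v := by
  constructor
  · intro h f
    have := h (FreeMonoid.lift f)
    simpa only [lift_wd] using this
  · intro h φ
    simp only [hom_wd]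
    exact h _

/-- A monoid in `F₀`. -/
inductive NF : Type uM
  | Y (i : Fin 3) : NF
  | S (i : Fin 3) : NF
  | O : NF

/-- Saturated addition. -/
def sat3 (i j : Fin 3) : Fin 3 := ⟨min 2 (i.1 + j.1), by omega⟩

theorem sat3_assoc : ∀ i j k, sat3 (sat3 i j) k = sat3 i (sat3 j k) := by decide
theorem sat3_zero : ∀ i, sat3 i 0 = i := by decide
theorem zero_sat3 : ∀ i, sat3 0 i = i := by decide
theorem sat3_comm : ∀ i j, sat3 i j = sat3 j i := by decide

/-- Multiplication. -/
def NF.mul : NF.{uM} → NF.{uM} → NF.{uM}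
  | .Y i, .Y j => .Y (sat3 i j)
  | .Y i, .S j => .S (sat3 i j)
  | .S i, .Y _ => .S i
  | _, _ => .O

instance : Monoid NF.{uM} where
  mul := NF.mul
  one := .Y 0
  mul_assoc a b c := by
    change NF.mul (NF.mul a b) c = NF.mul a (NF.mul b c)
    rcases a with i | i | _ <;> rcases b with j | j | _ <;> rcases c with k | k | _ <;>
      simp [NF.mul, sat3_assoc]
  one_mul a := by
    change NF.mul (.Y 0) a = a
    rcases a with i | i | _ <;> simp [NF.mul, zero_sat3]
  mul_one a := by
    change NF.mul a (.Y 0) = a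
    rcases a with i | i | _ <;> simp [NF.mul, sat3_zero]

theorem NF.one_def : (1 : NF.{uM}) = .Y 0 := rfl
@[simp] theorem NF.YY (i j : Fin 3) : (NF.Y i * NF.Y j : NF.{uM}) = .Y (sat3 i j) := rfl
@[simp] theorem NF.YS (i j : Fin 3) : (NF.Y i * NF.S j : NF.{uM}) = .S (sat3 i j) := rfl
@[simp] theorem NF.SY (i j : Fin 3) : (NF.S i * NF.Y j : NF.{uM}) = .S i := rfl
@[simp] theorem NF.SS (i j : Fin 3) : (NF.S i * NF.S j : NF.{uM}) = .O := rfl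
@[simp] theorem NF.Ol (a : NF.{uM}) : NF.O * a = .O := by
  rcases a with i | i | _ <;> rfl
@[simp] theorem NF.Or (a : NF.{uM}) : a * NF.O = .O := by
  rcases a with i | i | _ <;> rfl

theorem NF.sat : SatAll NF.{uM} F0set := by
  intro e he
  simp only [F0set, Set.mem_insert_iff, Set.mem_singleton_iff] at he
  rcases he with rfl | rfl | rfl | rfl <;> rw [msat_iff] <;> intro f <;>
    simp only [ev_cons, ev_nil, mul_one]
  · rcases f 0 with i | i | _ <;> rcases f 1 with j | j | _ <;> simp
    · revert i j; decide
  · rcases f 0 with i | i | _ <;> rcases f 1 with j | j | _ <;> simp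
    · revert i j; decide
  · rcases f 0 with i | i | _ <;> rcases f 1 with j | j | _ <;>
      rcases f 2 with k | k | _ <;> simp
    · revert i j k; decide
    · revert i j k; decide
  · rcases f 0 with i | i | _ <;> rcases f 1 with j | j | _ <;> simp
    · revert i j; decide

/-- A monoid in `E`. -/
inductive NE : Type uM
  | Y (i : Bool) : NE
  | S (i : Bool) : NE
  | O : NE

/-- Multiplication. -/
def NE.mul : NE.{uM} → NE.{uM} → NE.{uM}
  | .Y i, .Y j => .Y (i || j)
  | .Y _, .S j => .S j
  | .S i, .Y j => .S (i || j)
  | _, _ => .O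

instance : Monoid NE.{uM} where
  mul := NE.mul
  one := .Y false
  mul_assoc a b c := by
    change NE.mul (NE.mul a b) c = NE.mul a (NE.mul b c)
    rcases a with i | i | _ <;> rcases b with j | j | _ <;> rcases c with k | k | _ <;>
      simp [NE.mul, Bool.or_assoc]
  one_mul a := by
    change NE.mul (.Y false) a = a
    rcases a with i | i | _ <;> simp [NE.mul]
  mul_one a := by
    change NE.mul a (.Y false) = a
    rcases a with i | i | _ <;> simp [NE.mul]

theorem NE.one_def : (1 : NE.{uM}) = .Y false := rfl
@[simp] theorem NE.YY (i j : Bool) : (NE.Y i * NE.Y j : NE.{uM}) = .Y (i || j) := rfl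
@[simp] theorem NE.YS (i j : Bool) : (NE.Y i * NE.S j : NE.{uM}) = .S j := rfl
@[simp] theorem NE.SY (i j : Bool) : (NE.S i * NE.Y j : NE.{uM}) = .S (i || j) := rfl
@[simp] theorem NE.SS (i j : Bool) : (NE.S i * NE.S j : NE.{uM}) = .O := rfl
@[simp] theorem NE.Ol (a : NE.{uM}) : NE.O * a = .O := by
  rcases a with i | i | _ <;> rfl
@[simp] theorem NE.Or (a : NE.{uM}) : a * NE.O = .O := by
  rcases a with i | i | _ <;> rfl

theorem NE.sat : SatAll NE.{uM} Eset := by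
  intro e he
  simp only [Eset, Set.mem_insert_iff, Set.mem_singleton_iff] at he
  rcases he with rfl | rfl | rfl <;> rw [msat_iff] <;> intro f <;>
    simp only [ev_cons, ev_nil, mul_one] <;>
    rcases f 0 with i | i | _ <;> rcases f 1 with j | j | _ <;> simp <;>
    revert i j <;> decide

theorem cnt_of_sat {u v : List ℕ} (h : SatL NF.{uM} u v) (x : ℕ) :
    min 2 (u.count x) = min 2 (v.count x) := by
  have key : ∀ l : List ℕ, ev (fun n => if n = x then NF.Y.{uM} 1 else 1) l =
      NF.Y ⟨min 2 (l.count x), by omega⟩ := by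
    intro l
    induction l with
    | nil => rfl
    | cons a l ih =>
      rw [ev_cons, ih]
      by_cases ha : a = x
      · subst ha
        simp [sat3]; omega
      · simp [ha]
  have := h (fun n => if n = x then NF.Y.{uM} 1 else 1)
  rw [key, key] at this
  simpa using this

theorem h1_of_sat {u v : List ℕ} (h : SatL NF.{uM} u v) {s : ℕ} (x : ℕ) (hs : v.count s = 1) :
    min 2 ((bef s u).count x) = min 2 ((bef s v).count x) := by
  have hu : u.count s = 1 := by have := cnt_of_sat h s; omega
  by_cases hsx : s = x
  · subst hsx
    rw [cnt0 (not_mem_bef _ _), cnt0 (not_mem_bef _ _)]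
  have key : ∀ l : List ℕ, s ∉ l →
      ev (fun n => if n = s then NF.S.{uM} 0 else if n = x then NF.Y.{uM} 1 else 1) l =
      NF.Y ⟨min 2 (l.count x), by omega⟩ := by
    intro l
    induction l with
    | nil => intro _; rfl
    | cons a l ih =>
      intro hl
      simp only [List.mem_cons, not_or] at hl
      rw [ev_cons, ih hl.2]
      by_cases ha : a = x
      · subst ha
        simp [sat3, Ne.symm hl.1]; omega
      · simp [ha, Ne.symm hl.1]
  have key2 : ∀ l : List ℕ, l.count s = 1 →
      ev (fun n => if n = s then NF.S.{uM} 0 else if n = x then NF.Y.{uM} 1 else 1) l =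
      NF.S ⟨min 2 ((bef s l).count x), by omega⟩ := by
    intro l hl
    obtain ⟨r, hr, hb⟩ := bef_split (s := s) (w := l) (List.count_pos_iff.mp (by omega))
    have hsr : s ∉ r := by
      intro h'
      have := mem_cnt h'
      rw [hr] at hl
      simp [List.count_append] at hl; omega
    conv_lhs => rw [hr]
    rw [ev_append, ev_cons, key _ hb, key _ hsr]
    simp [sat3_zero]
  have := h (fun n => if n = s then NF.S.{uM} 0 else if n = x then NF.Y.{uM} 1 else 1)
  rw [key2 _ hu, key2 _ hs] at this
  simpa using this

theorem h2_of_sat {u v : List ℕ} (h : SatL NE.{uM} u v) {s : ℕ} (x : ℕ) (hs : v.count s = 1)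
    (hu : u.count s = 1) : Pr s x u ↔ Pr s x v := by
  by_cases hsx : s = x
  · subst hsx
    have : ∀ l : List ℕ, l.count s = 1 → ¬ Pr s s l := by
      intro l hl hp
      obtain ⟨r, hr, hb⟩ := bef_split (s := s) (w := l) (List.count_pos_iff.mp (by omega))
      have hsr : s ∉ r := by
        intro h'
        have := mem_cnt h'
        rw [hr] at hl
        simp [List.count_append] at hl; omega
      rw [hr] at hp
      have e1 : ¬ Pr s s (bef s l) := fun h => hb (pr_mem h).1
      have e2 : ¬ Pr s s r := fun h => hsr (pr_mem h).1
      simp [hb, hsr, e1, e2] at hp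
    simp [this u hu, this v hs]
  have key : ∀ l : List ℕ, s ∉ l →
      ev (fun n => if n = s then NE.S.{uM} false else if n = x then NE.Y.{uM} true else 1) l =
      NE.Y (decide (x ∈ l)) := by
    intro l
    induction l with
    | nil => intro _; rfl
    | cons a l ih =>
      intro hl
      simp only [List.mem_cons, not_or] at hl
      rw [ev_cons, ih hl.2]
      by_cases ha : a = x
      · subst ha
        simp [Ne.symm hl.1]
      · simp [ha, Ne.symm hl.1, Ne.symm ha]
  have key2 : ∀ l : List ℕ, l.count s = 1 → ∃ b : Bool, (b = true ↔ Pr s x l) ∧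
      ev (fun n => if n = s then NE.S.{uM} false else if n = x then NE.Y.{uM} true else 1) l =
      NE.S b := by
    intro l hl
    obtain ⟨r, hr, hb⟩ := bef_split (s := s) (w := l) (List.count_pos_iff.mp (by omega))
    have hsr : s ∉ r := by
      intro h'
      have := mem_cnt h'
      rw [hr] at hl
      simp [List.count_append] at hl; omega
    have e1 : ¬ Pr s x (bef s l) := fun h => hb (pr_mem h).1
    have e2 : ¬ Pr s x r := fun h => hsr (pr_mem h).1
    refine ⟨decide (x ∈ r), ?_, ?_⟩
    · conv_rhs => rw [hr]
      simp [hb, e1, e2]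
    · conv_lhs => rw [hr]
      rw [ev_append, ev_cons, key _ hb, key _ hsr]
      simp
  have := h (fun n => if n = s then NE.S.{uM} false else if n = x then NE.Y.{uM} true else 1)
  obtain ⟨b, hb, eb⟩ := key2 _ hu
  obtain ⟨b', hb', eb'⟩ := key2 _ hs
  rw [eb, eb'] at this
  have : b = b' := by simpa using this
  rw [← hb, ← hb', this]

/-! ### The condition `d` -/

theorem ev_pow {M : Type*} [Monoid M] (f : ℕ → M) (q : ℕ) (l : List ℕ)
    (h : ∀ n ∈ l, n ≠ q → f n = 1) : ev f l = f q ^ l.count q := by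
  induction l with
  | nil => simp
  | cons a l ih =>
    rw [ev_cons, ih (fun n hn => h n (by simp [hn]))]
    by_cases ha : a = q
    · subst ha; simp [pow_succ']
    · simp [ha, h a (by simp) ha]

/-- The substitution used for condition `d`. -/
def sub4 {M : Type*} [Monoid M] (x y z s : ℕ) (X Y Z T : M) (n : ℕ) : M :=
  if n = x then Y else if n = y then X else if n = z then Z else if n = s then T else 1

theorem sub4_word {w : List ℕ} {x y z s : ℕ} (hxy : x ≠ y) (hx : 2 ≤ w.count x)
    (hy : 2 ≤ w.count y) (hz : w.count z = 1) (hs : w.count s = 1) (hzx : (bef z w).count x = 0)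
    (hsx : (bef s w).count x = 1) (hsy : ¬ Pr s y w) :
    ∃ i a b k, i = (bef z w).count y ∧ (a ≠ 0 ↔ Pr z y (bef x w)) ∧ k ≠ 0 ∧
      w.count y = i + a + b ∧ ∀ (M : Type uM) [Monoid M] (X Y Z T : M),
        ev (sub4 x y z s X Y Z T) w = X ^ i * Z * X ^ a * Y * X ^ b * T * Y ^ k := by
  have hzs : z ≠ s := by rintro rfl; omega
  have hxz : x ≠ z := by rintro rfl; omega
  have hxs : x ≠ s := by rintro rfl; omega
  have hyz : y ≠ z := by rintro rfl; omega
  have hys : y ≠ s := by rintro rfl; omega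
  obtain ⟨r0, hr0, hz0⟩ := bef_split (s := z) (w := w) (List.count_pos_iff.mp (by omega))
  set w0 := bef z w with hw0
  have hx0 : x ∉ w0 := List.count_eq_zero.mp hzx
  have hs0 : s ∉ w0 := by
    intro h'
    obtain ⟨t, ht, -⟩ := bef_split h'
    rw [hr0, bef_append_mem h'] at hsx
    have : x ∈ bef s w0 := List.count_pos_iff.mp (by omega)
    apply hx0
    rw [ht]; simp [this]
  have hsr0 : s ∈ r0 := by
    have : s ∈ w := List.count_pos_iff.mp (by omega)
    rw [hr0] at this
    simpa [hs0, Ne.symm hzs] using this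
  obtain ⟨r2, hr2, hs1⟩ := bef_split hsr0
  set r1 := bef s r0 with hr1
  have hx1 : r1.count x = 1 := by
    rw [hr0, bef_append_not_mem hs0, bef_cons, if_neg hzs, ← hr1] at hsx
    simpa [List.count_append, hzx, Ne.symm hxz] using hsx
  obtain ⟨w1, w2, hw1, hxw1⟩ := split_first (s := x) (w := r1) (List.count_pos_iff.mp (by omega))
  clear_value w0 r1
  subst hw1 hr2
  have hxw2 : x ∉ w2 := by
    intro h'
    have := mem_cnt h'
    simp [List.count_append] at hx1; omega
  have hzx' : bef x w = w0 ++ z :: w1 := by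
    rw [hr0, bef_append_not_mem hx0, bef_cons, if_neg (Ne.symm hxz), List.append_assoc,
      bef_append_not_mem hxw1]
    simp
  rw [hzx']
  subst hr0
  have aux : ∀ q l, (q = z ∨ q = s) → (l = w1 ∨ l = w2 ∨ l = r2) → q ∉ l := by
    intro q l hq hl hql
    have e := mem_cnt hql
    simp only [List.count_append, List.count_cons] at hz hs
    rcases hq with rfl | rfl <;> rcases hl with rfl | rfl | rfl <;> simp at hz hs <;> omega
  have hyr2 : y ∉ r2 := by
    intro h'
    apply hsy
    simp [h']
  refine ⟨w0.count y, w1.count y, w2.count y, r2.count x, rfl, ?_, ?_, ?_, ?_⟩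
  · have e1 : ¬ Pr z y w0 := fun h => hz0 (pr_mem h).1
    have e2 : ¬ Pr z y w1 := fun h => aux z w1 (by simp) (by simp) (pr_mem h).1
    simp [e1, e2, hz0, List.count_eq_zero]
  · have e1 := cnt0 hxw1
    have e2 := cnt0 hxw2
    simp only [List.count_append, List.count_cons, beq_self_eq_true, if_true, beq_iff_eq,
      Ne.symm hxz, Ne.symm hxs, if_false] at hx
    omega
  · have e1 := cnt0 hyr2
    simp only [List.count_append, List.count_cons, beq_self_eq_true, if_true, beq_iff_eq,
      Ne.symm hyz, Ne.symm hys, hxy, if_false]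
    omega
  · intro M _ X Y Z T
    have fx : sub4 x y z s X Y Z T x = Y := by simp [sub4]
    have fy : sub4 x y z s X Y Z T y = X := by simp [sub4, Ne.symm hxy]
    have fz : sub4 x y z s X Y Z T z = Z := by simp [sub4, Ne.symm hxz, Ne.symm hyz]
    have fs : sub4 x y z s X Y Z T s = T := by
      simp [sub4, Ne.symm hxs, Ne.symm hys, Ne.symm hzs]
    have key : ∀ l : List ℕ, x ∉ l → z ∉ l → s ∉ l →
        ev (sub4 x y z s X Y Z T) l = X ^ l.count y := by
      intro l h1 h2 h3
      rw [ev_pow _ y, fy]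
      intro n hn hny
      have e1 : n ≠ x := by rintro rfl; exact h1 hn
      have e2 : n ≠ z := by rintro rfl; exact h2 hn
      have e3 : n ≠ s := by rintro rfl; exact h3 hn
      simp [sub4, e1, e2, e3, hny]
    have key2 : ∀ l : List ℕ, y ∉ l → z ∉ l → s ∉ l →
        ev (sub4 x y z s X Y Z T) l = Y ^ l.count x := by
      intro l h1 h2 h3
      rw [ev_pow _ x, fx]
      intro n hn hny
      have e1 : n ≠ y := by rintro rfl; exact h1 hn
      have e2 : n ≠ z := by rintro rfl; exact h2 hn
      have e3 : n ≠ s := by rintro rfl; exact h3 hn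
      simp [sub4, e1, e2, e3, hny]
    simp only [ev_append, ev_cons, fx, fz, fs]
    rw [key w0 hx0 hz0 hs0, key w1 hxw1 (aux _ _ (by simp) (by simp)) (aux _ _ (by simp) (by simp)),
      key w2 hxw2 (aux _ _ (by simp) (by simp)) (aux _ _ (by simp) (by simp)),
      key2 r2 hyr2 (aux _ _ (by simp) (by simp)) (aux _ _ (by simp) (by simp))]
    simp only [mul_assoc]

theorem target_of {M : Type*} [Monoid M] (hid : ∀ x y : M, x * y * x = x * y * x * x)
    {i a b k a' b' k' : ℕ} (hi : i ≤ 1) (ha : a = 0) (hb : b ≠ 0) (ha' : a' ≠ 0) (hk : k ≠ 0)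
    (hk' : k' ≠ 0)
    (h : ∀ X Y Z T : M, X ^ i * Z * X ^ a * Y * X ^ b * T * Y ^ k =
      X ^ i * Z * X ^ a' * Y * X ^ b' * T * Y ^ k') (X Y Z T : M) :
    X * Z * X * Y * X * T * Y = X * Z * Y * X * T * Y := by
  have hp : ∀ (x w : M) (n : ℕ), n ≠ 0 → x * w * x ^ n = x * w * x := by
    intro x w n hn
    induction n with
    | zero => exact absurd rfl hn
    | succ n ih =>
      rcases Nat.eq_zero_or_pos n with rfl | h0
      · simp
      · rw [pow_succ, ← mul_assoc, ih (by omega), ← hid]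
  have h1 : ∀ X Y Z T : M, X * Z * Y * X * T * Y = X * Z * X * Y * X ^ b' * T * Y := by
    intro X Y Z T
    have e0 : X * Z * Y * X ^ b * T * Y ^ k = X * Z * X ^ a' * Y * X ^ b' * T * Y ^ k' := by
      have := h X Y Z T
      subst ha
      interval_cases i
      · have := congrArg (fun q => X * q) this
        simpa [mul_assoc] using this
      · simpa [mul_assoc] using this
    have e1 : X * Z * Y * X ^ b * T * Y ^ k = X * Z * Y * X * T * Y := by
      have p1 := hp X (Z * Y) b hb
      have p2 := hp Y (X * T) k hk
      calc X * Z * Y * X ^ b * T * Y ^ k = (X * (Z * Y) * X ^ b) * T * Y ^ k := by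
            simp only [mul_assoc]
        _ = X * Z * (Y * (X * T) * Y ^ k) := by rw [p1]; simp only [mul_assoc]
        _ = _ := by rw [p2]; simp only [mul_assoc]
    have e2 : X * Z * X ^ a' * Y * X ^ b' * T * Y ^ k' = X * Z * X * Y * X ^ b' * T * Y := by
      have p1 := hp X Z a' ha'
      have p2 := hp Y (X ^ b' * T) k' hk'
      calc X * Z * X ^ a' * Y * X ^ b' * T * Y ^ k' =
          (X * Z * X ^ a') * (Y * (X ^ b' * T) * Y ^ k') := by simp only [mul_assoc]
        _ = _ := by rw [p1, p2]; simp only [mul_assoc]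
    rw [← e1, e0, e2]
  by_cases hb' : b' = 0
  · subst hb'
    have g1 := h1 X Y Z T
    have g2 := h1 X Y (Z * X) T
    simp only [pow_zero, mul_one] at g1 g2
    rw [g1]
    have e3 : X * (Z * X) * Y * X * T * Y = X * Z * X * Y * X * T * Y := by simp only [mul_assoc]
    rw [← e3, g2]
    have := hid X Z
    calc X * (Z * X) * X * Y * T * Y = (X * Z * X * X) * Y * T * Y := by simp only [mul_assoc]
      _ = _ := by rw [← this]
  · have p1 := hp X (Z * X * Y) b' hb'
    rw [h1]
    have : X * Z * X * Y * X ^ b' * T * Y = (X * (Z * X * Y) * X ^ b') * T * Y := by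
      simp only [mul_assoc]
    rw [this, p1]
    simp only [mul_assoc]

theorem winv_of_sat {u v : List ℕ} (hF : SatL NF.{uM} u v) (hE : SatL NE.{uM} u v)
    {M : Type uM} [Monoid M] (hM : SatL M u v) (hid : ∀ x y : M, x * y * x = x * y * x * x)
    (ht : ¬ ∀ X Y Z T : M, X * Z * X * Y * X * T * Y = X * Z * Y * X * T * Y) : WInv u v := by
  have cnt := cnt_of_sat hF
  have sim : ∀ s, v.count s = 1 → u.count s = 1 := by intro s hs; have := cnt s; omega
  have h1 : ∀ s x, v.count s = 1 → min 2 ((bef s u).count x) = min 2 ((bef s v).count x) :=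
    fun s x hs => h1_of_sat hF x hs
  have h2 : ∀ s x, v.count s = 1 → (Pr s x u ↔ Pr s x v) :=
    fun s x hs => h2_of_sat hE x hs (sim s hs)
  refine ⟨cnt, h1, h2, ?_⟩
  intro x y z s hxy hx hy hz hs hzx hsx hsy hyz
  have hzv : (bef z v).count x = 0 := by
    obtain ⟨r, hr, hb⟩ := bef_split (s := x) (w := v) (List.count_pos_iff.mp (by omega))
    have e : bef z v = bef z (bef x v) := by
      conv_lhs => rw [hr]
      exact bef_append_mem hzx _
    obtain ⟨t, ht, -⟩ := bef_split hzx
    rw [e]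
    apply cnt0
    intro h'
    apply hb
    rw [ht]; simp [h']
  obtain ⟨i, a, b, k, hi, ha, hk, hc, hw⟩ := sub4_word.{uM} hxy hx hy hz hs hzv hsx hsy
  have c1 := cnt x
  have c2 := cnt y
  have c3 := h1 z x hz
  have c4 := h1 s x hs
  have c5 := h1 z y hz
  obtain ⟨i', a', b', k', hi', ha', hk', hc', hw'⟩ := sub4_word.{uM} (w := u) hxy (by omega)
    (by omega) (sim z hz) (sim s hs) (by omega) (by omega) (by rwa [h2 s y hs])
  have hii : i' = i := by omega
  subst hii
  have heq : ∀ X Y Z T : M, X ^ i' * Z * X ^ a' * Y * X ^ b' * T * Y ^ k' =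
      X ^ i' * Z * X ^ a * Y * X ^ b * T * Y ^ k := by
    intro X Y Z T
    rw [← hw, ← hw']
    exact hM _
  rw [← ha, ← ha']
  by_contra hne
  apply ht
  by_cases h0 : a = 0
  · exact target_of hid (i := i') (a := a) (b := b) (k := k) (a' := a') (b' := b') (k' := k')
      (by omega) h0 (by omega) (by tauto) hk hk' (fun X Y Z T => (heq X Y Z T).symm)
  · exact target_of hid (i := i') (a := a') (b := b') (k := k') (a' := a) (b' := b) (k' := k)
      (by omega) (by tauto) (by have : a' = 0 := by tauto
                                omega) h0 hk' hk heq

theorem jsat_of {u v : List ℕ} (hF : SatL NF.{uM} u v) (hE : SatL NE.{uM} u v)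
    {M : Type uM} [Monoid M] (hM : SatL M u v) (hid : ∀ x y : M, x * y * x = x * y * x * x)
    (ht : ¬ ∀ X Y Z T : M, X * Z * X * Y * X * T * Y = X * Z * Y * X * T * Y)
    {N : Type uM} [Monoid N] (hN : JM N) : SatL N u v := by
  obtain ⟨s0, hs0⟩ := Infinite.exists_notMem_finset (u ++ v).toFinset
  obtain ⟨s1, hs1⟩ := Infinite.exists_notMem_finset (s0 :: (u ++ v)).toFinset
  simp at hs0 hs1
  have pad : ∀ {K : Type uM} [Monoid K], SatL K u v →
      SatL K ([s0] ++ (u ++ [s1])) ([s0] ++ (v ++ [s1])) := by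
    intro K _ h f
    simp [h f]
  have hW := winv_of_sat (pad hF) (pad hE) (pad hM) hid ht
  intro f
  have c0 : v.count s0 = 0 := cnt0 hs0.2
  have c1 : v.count s1 = 0 := cnt0 hs1.2.2
  have key := main_reduction (fun n => if n = s0 ∨ n = s1 then 1 else f n) hN (v ++ [s1]) [s0]
    (u ++ [s1]) hW ⟨s0, by simp, by simp [List.count_append, c0, hs1.1]⟩
    ⟨s0 :: v, s1, by simp, by simp [List.count_append, c1, Ne.symm hs1.1]⟩
  have e : ∀ l : List ℕ, s0 ∉ l → s1 ∉ l →
      ev (fun n => if n = s0 ∨ n = s1 then 1 else f n) l = ev f l := by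
    intro l h0 h1
    unfold ev
    congr 1
    apply List.map_congr_left
    intro n hn
    have e1 : n ≠ s0 := by rintro rfl; exact h0 hn
    have e2 : n ≠ s1 := by rintro rfl; exact h1 hn
    simp [e1, e2]
  simp only [ev_append, ev_cons, ev_nil] at key
  rw [e u hs0.1 hs1.2.1, e v hs0.2 hs1.2.2] at key
  simpa using key

/-- If a variety `Mod S` contains `F₀` and `E`, satisfies `xyx ≈ xyx²` and does not
contain `J`, then it satisfies `xzxyxty ≈ xzyxty`. -/
theorem satisfies_xzxyxty_of_not_contains_J (S : Set (Word × Word))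
    (hF : ∀ (M : Type uM) [Monoid M], SatAll M F0set → SatAll M S)
    (hE : ∀ (M : Type uM) [Monoid M], SatAll M Eset → SatAll M S)
    (hid : ∀ (M : Type uM) [Monoid M], SatAll M S → MSat M (wd [0,1,0], wd [0,1,0,0]))
    (hJ : ∃ (M : Type uM) (inst : Monoid M), @SatAll M inst Jset ∧ ¬ @SatAll M inst S) :
    ∀ (M : Type uM) [Monoid M], SatAll M S → MSat M (wd [0,2,0,1,0,3,1], wd [0,2,1,0,3,1]) := by
  intro M _ hM
  rw [msat_iff]
  have hid' : ∀ x y : M, x * y * x = x * y * x * x := by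
    intro x y
    have := (msat_iff _ _).1 (hid M hM) (fun n => if n = 0 then x else y)
    simpa [mul_assoc] using this
  by_contra hcon
  have ht : ¬ ∀ X Y Z T : M, X * Z * X * Y * X * T * Y = X * Z * Y * X * T * Y := by
    intro h
    apply hcon
    intro f
    have := h (f 0) (f 1) (f 2) (f 3)
    simpa [mul_assoc] using this
  obtain ⟨N, inst, hN, hNS⟩ := hJ
  apply hNS
  intro e he
  have conv : ∀ (K : Type uM) [Monoid K], MSat K e ↔ SatL K (toList e.1) (toList e.2) :=
    fun K _ => msat_iff (toList e.1) (toList e.2)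
  rw [conv N]
  exact jsat_of ((conv _).1 (hF _ NF.sat e he)) ((conv _).1 (hE _ NE.sat e he))
    ((conv M).1 (hM e he)) hid' ht (jm_of_sat hN)
end

section
/- Every monoid satisfying the identities xyx ≈ xyx² and x²yzx² ≈ x²yxzx² also satisfies the identity xyxztx ≈ xyxzxtx. -/
open FreeMonoid

/-- Every monoid satisfying `xyx ≈ xyx²` and `x²yzx² ≈ x²yxzx²` also satisfies
`xyxztx ≈ xyxzxtx` (letters `x = 0`, `y = 1`, `z = 2`, `t = 3`). -/
theorem derive_xyxztx (M : Type*) [Monoid M]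
    (h1 : MSat M (wd [0,1,0], wd [0,1,0,0]))
    (h2 : MSat M (wd [0,0,1,2,0,0], wd [0,0,1,0,2,0,0])) :
    MSat M (wd [0,1,0,2,3,0], wd [0,1,0,2,0,3,0]) := by
  intro φ
  have key1 : ∀ a b : M, a * (b * a) = a * (b * (a * a)) := by
    intro a b
    have := h1 (FreeMonoid.lift fun n => if n = 0 then a else b)
    simpa [wd, FreeMonoid.lift_apply, mul_assoc] using this
  have key2 : ∀ a b c : M, a * (a * (b * (c * (a * a)))) =
      a * (a * (b * (a * (c * (a * a))))) := by
    intro a b c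
    have := h2 (FreeMonoid.lift fun n => if n = 0 then a else if n = 1 then b else c)
    simpa [wd, FreeMonoid.lift_apply, mul_assoc] using this
  have e1 : ∀ l : List ℕ, φ (wd l) = (l.map fun n => φ (of n)).prod := by
    intro l
    induction l with
    | nil => exact φ.map_one
    | cons n l ih =>
      have : wd (n :: l) = of n * wd l := rfl
      rw [this, map_mul, ih, List.map_cons, List.prod_cons]
  simp only [e1, List.map_cons, List.map_nil, List.prod_cons, List.prod_nil, mul_one]
  generalize φ (of 0) = x
  generalize φ (of 1) = y
  generalize φ (of 2) = z
  generalize φ (of 3) = t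
  have k : ∀ w : M, x * (y * (x * w)) = x * (y * (x * (x * w))) := by
    intro w
    have := congrArg (· * w) (key1 x y)
    simpa [mul_assoc] using this
  have p := key1 x (z * t)
  have q := key1 x t
  simp only [mul_assoc] at p
  calc x * (y * (x * (z * (t * x))))
      = x * (y * (x * (z * (t * (x * x))))) := by rw [p]
    _ = x * (y * (x * (x * (z * (t * (x * x)))))) := k _
    _ = x * (y * (x * (x * (z * (x * (t * (x * x))))))) := by rw [key2]
    _ = x * (y * (x * (z * (x * (t * (x * x)))))) := (k _).symm
    _ = x * (y * (x * (z * (x * (t * x))))) := by rw [← q]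
end
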